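/- Let t, d be positive integers, let k be an integer such that no graph in C_t contains two distinct non-adjacent vertices x, y with N(x) ∩ Hub = ∅ that are joined by k pairwise internally vertex-disjoint paths, and let m = k + 2d, with m ≥ 3. Let G ∈ C_t, let (T,χ) be an m-atomic tree decomposition of G and let t0 be a node of T. If u, v ∈ χ(t0) are both d-safe (i.e., each has at most d neighbors in Hub(G)) and neither is t0-cooperative (i.e., each has degree at least 2m(m−1) in the torso at t0), then u is adjacent to v. -/

import Mathlib

open Set

/-- `f` enumerates an induced path on `n` vertices in `G`. -/
def IsPathEmb {α : Type} (G : SimpleGraph α) (n : ℕ) (f : Fin n → α) : Prop :=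
  Function.Injective f ∧
    ∀ i j : Fin n, G.Adj (f i) (f j) ↔ (i.val = j.val + 1 ∨ j.val = i.val + 1)

/-- `f` enumerates an induced path from `a` to `b`. -/
def IsPathFromTo {α : Type} (G : SimpleGraph α) (n : ℕ) (f : Fin n → α) (a b : α) : Prop :=
  IsPathEmb G n f ∧ ∃ h : 1 ≤ n, f ⟨0, h⟩ = a ∧ f ⟨n - 1, by omega⟩ = b

/-- The interior (internal vertices) of the path enumerated by `f`. -/
def pathInterior {α : Type} (n : ℕ) (f : Fin n → α) : Set α :=
  {v | ∃ j : Fin n, 0 < j.val ∧ j.val < n - 1 ∧ f j = v}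

/-- `k` pairwise internally vertex-disjoint induced paths from `a` to `b` in `G`. -/
def KDisjointPaths {α : Type} (G : SimpleGraph α) (k : ℕ) (a b : α) : Prop :=
  ∃ (n : Fin k → ℕ) (f : ∀ i, Fin (n i) → α),
    (∀ i, IsPathFromTo G (n i) (f i) a b) ∧
    (∀ i j, i ≠ j → Disjoint (pathInterior (n i) (f i)) (pathInterior (n j) (f j)))

/-- `f` enumerates an induced cycle on `n` vertices. -/
def IsHoleEmb {α : Type} (G : SimpleGraph α) (n : ℕ) (f : ZMod n → α) : Prop :=
  Function.Injective f ∧ ∀ i j : ZMod n, G.Adj (f i) (f j) ↔ (i = j + 1 ∨ j = i + 1)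

/-- `H` is the vertex set of a hole of `G` (an induced cycle with at least 4 vertices). -/
def IsHole {α : Type} (G : SimpleGraph α) (H : Set α) : Prop :=
  ∃ (n : ℕ) (f : ZMod n → α), 4 ≤ n ∧ IsHoleEmb G n f ∧ Set.range f = H

/-- `G` has no even hole. -/
def EvenHoleFree {α : Type} (G : SimpleGraph α) : Prop :=
  ∀ H : Set α, IsHole G H → ¬ Even H.ncard

def Anticomplete {α : Type} (G : SimpleGraph α) (A B : Set α) : Prop :=
  ∀ a ∈ A, ∀ b ∈ B, ¬ G.Adj a b

/-- `X` is a stable (independent) set of `G`. -/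
def StableSet {α : Type} (G : SimpleGraph α) (X : Set α) : Prop :=
  ∀ a ∈ X, ∀ b ∈ X, a ≠ b → ¬ G.Adj a b

/-- The open neighborhood of the set `A`. -/
def setNbhd {α : Type} (G : SimpleGraph α) (A : Set α) : Set α :=
  {v | v ∉ A ∧ ∃ a ∈ A, G.Adj v a}

/-- The set `A` induces a connected (nonempty) subgraph of `G`. -/
def ConnSet {α : Type} (G : SimpleGraph α) (A : Set α) : Prop :=
  (G.induce A).Connected

/-- `D` is a connected component of the subgraph of `G` induced by `S`. -/
def IsCompOf {α : Type} (G : SimpleGraph α) (S D : Set α) : Prop :=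
  D ⊆ S ∧ ConnSet G D ∧ ∀ D', D ⊆ D' → D' ⊆ S → ConnSet G D' → D' = D

/-- `G` contains an (induced) theta. -/
def HasTheta {α : Type} (G : SimpleGraph α) : Prop :=
  ∃ (a b : α) (n : Fin 3 → ℕ) (f : ∀ i, Fin (n i) → α),
    a ≠ b ∧ ¬ G.Adj a b ∧ (∀ i, 3 ≤ n i) ∧
    (∀ i, IsPathFromTo G (n i) (f i) a b) ∧
    (∀ i j : Fin 3, i ≠ j → ∀ (u : Fin (n i)) (v : Fin (n j)),
      0 < u.val → u.val < n i - 1 → 0 < v.val → v.val < n j - 1 →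
      f i u ≠ f j v ∧ ¬ G.Adj (f i u) (f j v))

/-- `G` contains an (induced) prism. -/
def HasPrism {α : Type} (G : SimpleGraph α) : Prop :=
  ∃ (n : Fin 3 → ℕ) (f : ∀ i, Fin (n i) → α),
    (∀ i, 2 ≤ n i) ∧ (∀ i, IsPathEmb G (n i) (f i)) ∧
    (∀ i j : Fin 3, i ≠ j → ∀ u v, f i u ≠ f j v) ∧
    (∀ i j : Fin 3, i ≠ j → ∀ (u : Fin (n i)) (v : Fin (n j)),
      G.Adj (f i u) (f j v) ↔
        ((u.val = 0 ∧ v.val = 0) ∨ (u.val = n i - 1 ∧ v.val = n j - 1)))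

/-- The neighbors of `x` in the hole `H`. -/
def holeNbrs {α : Type} (G : SimpleGraph α) (H : Set α) (x : α) : Set α :=
  {v ∈ H | G.Adj x v}

def IsWheel {α : Type} (G : SimpleGraph α) (H : Set α) (x : α) : Prop :=
  IsHole G H ∧ x ∉ H ∧ 3 ≤ (holeNbrs G H x).ncard

def IsTwinWheel {α : Type} (G : SimpleGraph α) (H : Set α) (x : α) : Prop :=
  IsWheel G H x ∧ ∃ p q r : α, p ≠ q ∧ q ≠ r ∧ p ≠ r ∧
    holeNbrs G H x = {p, q, r} ∧ G.Adj p q ∧ G.Adj q r ∧ ¬ G.Adj p r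

def IsShortPyramid {α : Type} (G : SimpleGraph α) (H : Set α) (x : α) : Prop :=
  IsWheel G H x ∧ ∃ p q r : α, p ≠ q ∧ q ≠ r ∧ p ≠ r ∧
    holeNbrs G H x = {p, q, r} ∧ G.Adj p q ∧ ¬ G.Adj q r ∧ ¬ G.Adj p r

def IsProperWheel {α : Type} (G : SimpleGraph α) (H : Set α) (x : α) : Prop :=
  IsWheel G H x ∧ ¬ IsTwinWheel G H x ∧ ¬ IsShortPyramid G H x

/-- `x` is a hub of the induced subgraph `G[W]`. -/
def IsHubIn {α : Type} (G : SimpleGraph α) (W : Set α) (x : α) : Prop :=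
  x ∈ W ∧ ∃ H : Set α, H ⊆ W ∧ IsProperWheel G H x

/-- `x` is a hub of `G`: the center of some proper wheel. -/
def IsHub {α : Type} (G : SimpleGraph α) (x : α) : Prop :=
  ∃ H : Set α, IsProperWheel G H x

/-- membership in the class `𝒞` of (C₄, theta, prism, even wheel)-free graphs. -/
def MemC {α : Type} (G : SimpleGraph α) : Prop :=
  (∀ H : Set α, IsHole G H → H.ncard ≠ 4) ∧ ¬ HasTheta G ∧ ¬ HasPrism G ∧
    (∀ (H : Set α) (x : α), IsWheel G H x → ¬ Even (holeNbrs G H x).ncard)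

/-- membership in the class `𝒞ₜ`: graphs in `𝒞` with no clique of size `t`. -/
def MemCt {α : Type} (t : ℕ) (G : SimpleGraph α) : Prop :=
  MemC G ∧ G.CliqueFree t

/-- `G` contains a generalized `k`-pyramid as an induced subgraph. -/
def ContainsGenPyramid {α : Type} (G : SimpleGraph α) (k : ℕ) : Prop :=
  ∃ (nP nQ : ℕ) (P : Fin nP → α) (Q : Fin nQ → α)
    (m : Fin k → ℕ) (R : ∀ i, Fin (m i) → α) (xI zI : Fin k → ℕ),
    4 ≤ nP + nQ ∧ 1 ≤ nP ∧ 1 ≤ nQ ∧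
    IsPathEmb G nP P ∧ IsPathEmb G nQ Q ∧
    (∀ i j, P i ≠ Q j) ∧
    (∀ (i : Fin nP) (j : Fin nQ), G.Adj (P i) (Q j) ↔
      ((i.val = 0 ∧ j.val = 0) ∨ (i.val = nP - 1 ∧ j.val = nQ - 1))) ∧
    (∀ i, 1 ≤ m i) ∧ (∀ i, IsPathEmb G (m i) (R i)) ∧
    (∀ i u j, R i u ≠ P j) ∧ (∀ i u j, R i u ≠ Q j) ∧
    (∀ i i', i ≠ i' → ∀ u u', R i u ≠ R i' u' ∧ ¬ G.Adj (R i u) (R i' u')) ∧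
    (∀ i, 0 < xI i ∧ xI i + 1 < nP - 1) ∧
    (∀ (i : Fin k) (u : Fin (m i)) (j : Fin nP), G.Adj (R i u) (P j) ↔
      (u.val = 0 ∧ (j.val = xI i ∨ j.val = xI i + 1))) ∧
    (∀ i, zI i < nQ) ∧
    (∀ (i : Fin k) (u : Fin (m i)) (j : Fin nQ), G.Adj (R i u) (Q j) ↔
      (u.val = m i - 1 ∧ j.val = zI i)) ∧
    (∀ i i' : Fin k, i < i' → xI i + 1 < xI i') ∧
    (∀ i i' : Fin k, i ≤ i' → zI i ≤ zI i')

/-- membership in the class `𝒞ₜₜ`: graphs in `𝒞ₜ` with no induced generalized `t`-pyramid. -/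
def MemCtt {α : Type} (t : ℕ) (G : SimpleGraph α) : Prop :=
  MemCt t G ∧ ¬ ContainsGenPyramid G t

/-- `(T, χ)` is a tree decomposition of `G`. -/
structure IsTD {α ι : Type} (G : SimpleGraph α) (T : SimpleGraph ι) (χ : ι → Set α) : Prop where
  finite : Finite ι
  isTree : T.IsTree
  memBag : ∀ v : α, ∃ t, v ∈ χ t
  edgeBag : ∀ ⦃u v : α⦄, G.Adj u v → ∃ t, u ∈ χ t ∧ v ∈ χ t
  subtree : ∀ v : α, (T.induce {t | v ∈ χ t}).Connected

/-- `G` has a tree decomposition of width at most `w`. -/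
def TwLE {α : Type} (G : SimpleGraph α) (w : ℕ) : Prop :=
  ∃ (ι : Type) (T : SimpleGraph ι) (χ : ι → Set α),
    IsTD G T χ ∧ ∀ t, (χ t).ncard ≤ w + 1

/-- The treewidth of `G`. -/
noncomputable def treeWidth {α : Type} (G : SimpleGraph α) : ℕ :=
  sInf {w | TwLE G w}

/-- For adjacent `t, t'` in a tree `T`, the vertex set of the component of `T - t`
containing `t'`. -/
def branchSet {ι : Type} (T : SimpleGraph ι) (t t' : ι) : Set ι :=
  {s | ∀ w : T.Walk s t, t' ∈ w.support}

/-- The vertex set of `G_{t → t'}`: the union of the bags over the component of `T - t`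
containing `t'`. -/
def sideSet {α ι : Type} (T : SimpleGraph ι) (χ : ι → Set α) (t t' : ι) : Set α :=
  ⋃ s ∈ branchSet T t t', χ s

/-- `(T, χ)` is a tight tree decomposition of `G`. -/
def TightTD {α ι : Type} (G : SimpleGraph α) (T : SimpleGraph ι) (χ : ι → Set α) : Prop :=
  IsTD G T χ ∧ ∀ ⦃t t' : ι⦄, T.Adj t t' →
    ∃ D, IsCompOf G (sideSet T χ t t' \ χ t) D ∧ setNbhd G D = χ t ∩ χ t'

/-- `G` admits a clique cutset. -/
def HasCliqueCutset {α : Type} (G : SimpleGraph α) : Prop :=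
  ∃ C : Set α, G.IsClique C ∧ ¬ (G.induce (Set.univ \ C)).Preconnected

/-- `G` is chordal: it has no hole. -/
def ChordalG {α : Type} (G : SimpleGraph α) : Prop := ∀ H : Set α, ¬ IsHole G H

/-- `G'` is a minimal chordal completion of `G`. -/
def IsMinChordalCompletion {α : Type} (G G' : SimpleGraph α) : Prop :=
  G ≤ G' ∧ ChordalG G' ∧ ∀ G'', G ≤ G'' → G'' ≤ G' → ChordalG G'' → G'' = G'

/-- `Ω` is a potential maximal clique of `G` : a maximal clique of some minimal chordal
completion of `G`. -/
def IsPMC {α : Type} (G : SimpleGraph α) (Ω : Set α) : Prop :=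
  ∃ G' : SimpleGraph α, IsMinChordalCompletion G G' ∧ G'.IsClique Ω ∧
    ∀ Ω' : Set α, G'.IsClique Ω' → Ω ⊆ Ω' → Ω' = Ω

/-- `(T, χ)` is a structured tree decomposition: every bag is a PMC of `G`. -/
def StructuredTD {α ι : Type} (G : SimpleGraph α) (T : SimpleGraph ι) (χ : ι → Set α) : Prop :=
  IsTD G T χ ∧ ∀ t, IsPMC G (χ t)

/-- the decomposition has adhesion less than `m`. -/
def AdhLT {α ι : Type} (T : SimpleGraph ι) (χ : ι → Set α) (m : ℕ) : Prop :=
  ∀ ⦃t t' : ι⦄, T.Adj t t' → (χ t ∩ χ t').ncard < m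

/-- `fatness χ i` is the number of bags of size `i`. -/
noncomputable def fatness {α ι : Type} (χ : ι → Set α) (i : ℕ) : ℕ :=
  {t : ι | (χ t).ncard = i}.ncard

/-- Lexicographic comparison of fatness vectors `(aₙ, …, a₀)` (larger sizes more
significant). -/
def FatLexLE (f g : ℕ → ℕ) : Prop :=
  (∀ i, f i = g i) ∨ ∃ j, f j < g j ∧ ∀ i, j < i → f i = g i

/-- `(T, χ)` is an `m`-atomic tree decomposition of `G`: its adhesion is less than `m` and its
fatness is lexicographically minimum among all tree decompositions with adhesion less than `m`. -/
def IsAtomicTD {α ι : Type} (m : ℕ) (G : SimpleGraph α) (T : SimpleGraph ι)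
    (χ : ι → Set α) : Prop :=
  IsTD G T χ ∧ AdhLT T χ m ∧
    ∀ (ι' : Type) (T' : SimpleGraph ι') (χ' : ι' → Set α),
      IsTD G T' χ' → AdhLT T' χ' m → FatLexLE (fatness χ) (fatness χ')

/-- Adjacency in the torso at the node `x` of the tree decomposition. -/
def torsoAdj {α ι : Type} (G : SimpleGraph α) (T : SimpleGraph ι) (χ : ι → Set α)
    (x : ι) (u v : α) : Prop :=
  u ∈ χ x ∧ v ∈ χ x ∧ u ≠ v ∧
    (G.Adj u v ∨ ∃ y, T.Adj x y ∧ u ∈ χ y ∧ v ∈ χ y)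

/-- The degree of `u` in the torso at `x`. -/
noncomputable def torsoDeg {α ι : Type} (G : SimpleGraph α) (T : SimpleGraph ι)
    (χ : ι → Set α) (x : ι) (u : α) : ℕ :=
  {v | torsoAdj G T χ x u v}.ncard

/-- `u` and `v` lie in the same component of `G[S]`. -/
def SameComp {α : Type} (G : SimpleGraph α) (S : Set α) (u v : α) : Prop :=
  ∃ (hu : u ∈ S) (hv : v ∈ S), (G.induce S).Reachable ⟨u, hu⟩ ⟨v, hv⟩

/-- `X` is a minimal separator of `G`. -/
def IsMinimalSeparator {α : Type} (G : SimpleGraph α) (X : Set α) : Prop :=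
  ∃ u v : α, u ∉ X ∧ v ∉ X ∧ ¬ SameComp G (Set.univ \ X) u v ∧
    ∀ Y : Set α, Y ⊂ X → SameComp G (Set.univ \ Y) u v
/-- The degree of `v` in `H` (as the cardinality of its neighbor set). -/
noncomputable def degreeSet {α : Type} (H : SimpleGraph α) (v : α) : ℕ :=
  (H.neighborSet v).ncard

/-- `H` is a path (as a graph). -/
def IsPathGraph {α : Type} (H : SimpleGraph α) : Prop :=
  ∃ (n : ℕ) (f : Fin n → α), Function.Bijective f ∧
    ∀ i j, H.Adj (f i) (f j) ↔ (i.val = j.val + 1 ∨ j.val = i.val + 1)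

/-- `H` is a caterpillar: a tree of maximum degree three having a path containing all
branch vertices. -/
def IsCaterpillar {α : Type} (H : SimpleGraph α) : Prop :=
  H.IsTree ∧ (∀ v, degreeSet H v ≤ 3) ∧
    ∃ (n : ℕ) (f : Fin n → α), IsPathEmb H n f ∧
      ∀ v, 2 < degreeSet H v → v ∈ Set.range f

/-- `H` is a subdivided star: a tree with exactly one branch vertex (its root), of degree
at least 3. -/
def IsSubdividedStar {α : Type} (H : SimpleGraph α) : Prop :=
  H.IsTree ∧ ∃! r, 2 < degreeSet H r

/-- `H` is (isomorphic to) the line graph of a caterpillar. -/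
def IsLineGraphOfCaterpillar {α : Type} (H : SimpleGraph α) : Prop :=
  ∃ (β : Type) (C : SimpleGraph β), IsCaterpillar C ∧
    Nonempty (SimpleGraph.Iso H C.lineGraph)

/-- `w` is a simplicial vertex of the induced subgraph `G[W]`. -/
def SimplicialIn {α : Type} (G : SimpleGraph α) (W : Set α) (w : α) : Prop :=
  w ∈ W ∧ G.IsClique {u | u ∈ W ∧ G.Adj w u}

/-- `(p, x)` is an alignment: `p` enumerates an induced path, `x` enumerates the set `X`
in the order given by the alignment. -/
structure IsAlignment {α : Type} (G : SimpleGraph α) (n : ℕ) (p : Fin n → α)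
    (k : ℕ) (x : Fin k → α) : Prop where
  hn : 1 ≤ n
  hk : 2 ≤ k
  path : IsPathEmb G n p
  injx : Function.Injective x
  disj : ∀ i j, x i ≠ p j
  cover : ∀ i, ∃ j, G.Adj (x i) (p j)
  first : ∀ j : Fin n, G.Adj (x ⟨0, by omega⟩) (p j) ↔ j.val = 0
  last : ∀ j : Fin n, G.Adj (x ⟨k - 1, by omega⟩) (p j) ↔ j.val = n - 1
  ordered : ∀ (i i' : Fin k) (j j' : Fin n),
    i < i' → G.Adj (x i) (p j) → G.Adj (x i') (p j') → j < j'

/-- A wide alignment: every middle vertex of `X` has two non-adjacent neighbors in `P`. -/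
def IsWideAlignment {α : Type} (G : SimpleGraph α) (n : ℕ) (p : Fin n → α)
    (k : ℕ) (x : Fin k → α) : Prop :=
  IsAlignment G n p k x ∧ ∀ i : Fin k, 0 < i.val → i.val < k - 1 →
    ∃ j j' : Fin n, j.val + 1 < j'.val ∧ G.Adj (x i) (p j) ∧ G.Adj (x i) (p j')

/-- A spiky alignment: every middle vertex of `X` has a unique neighbor in `P`. -/
def IsSpikyAlignment {α : Type} (G : SimpleGraph α) (n : ℕ) (p : Fin n → α)
    (k : ℕ) (x : Fin k → α) : Prop :=
  IsAlignment G n p k x ∧ ∀ i : Fin k, 0 < i.val → i.val < k - 1 →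
    ∃! j : Fin n, G.Adj (x i) (p j)

/-- A triangular alignment: every middle vertex of `X` has exactly two neighbors in `P`,
and they are adjacent. -/
def IsTriangularAlignment {α : Type} (G : SimpleGraph α) (n : ℕ) (p : Fin n → α)
    (k : ℕ) (x : Fin k → α) : Prop :=
  IsAlignment G n p k x ∧ ∀ i : Fin k, 0 < i.val → i.val < k - 1 →
    ∃ j : Fin n, j.val + 1 < n ∧
      ∀ j' : Fin n, G.Adj (x i) (p j') ↔ (j'.val = j.val ∨ j'.val = j.val + 1)

/-- `(H, x)` is a spiky connectifier: `H` is an induced caterpillar with spine `p` and legs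
`ℓ`, and `x` enumerates `X` in the order given by the connectifier (`x 0` and `x (k-1)`
attached at the ends of the spine, the others to the tips of the legs, in the order in which
the legs attach along the spine). -/
def IsSpikyConnectifier {α : Type} (G : SimpleGraph α) (H : Set α)
    (k : ℕ) (x : Fin k → α) : Prop :=
  ∃ (hk : 2 ≤ k) (n : ℕ) (_ : 2 ≤ n) (p : Fin n → α)
    (m : Fin (k - 2) → ℕ) (ℓ : ∀ i, Fin (m i) → α) (a : Fin (k - 2) → ℕ),
    IsPathEmb G n p ∧ (∀ i, 1 ≤ m i) ∧ (∀ i, IsPathEmb G (m i) (ℓ i)) ∧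
    H = Set.range p ∪ ⋃ i, Set.range (ℓ i) ∧
    Function.Injective x ∧ (∀ i, x i ∉ H) ∧
    (∀ i j j', ℓ i j ≠ p j') ∧
    (∀ i i', i ≠ i' → ∀ j j', ℓ i j ≠ ℓ i' j' ∧ ¬ G.Adj (ℓ i j) (ℓ i' j')) ∧
    (∀ i, 0 < a i ∧ a i < n - 1) ∧
    (∀ i i', i < i' → a i < a i') ∧
    (∀ (i : Fin (k - 2)) (j : Fin (m i)) (j' : Fin n),
      G.Adj (ℓ i j) (p j') ↔ (j.val = 0 ∧ j'.val = a i)) ∧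
    (∀ j : Fin n, G.Adj (x ⟨0, by omega⟩) (p j) ↔ j.val = 0) ∧
    (∀ (i : Fin (k - 2)) (j : Fin (m i)), ¬ G.Adj (x ⟨0, by omega⟩) (ℓ i j)) ∧
    (∀ j : Fin n, G.Adj (x ⟨k - 1, by omega⟩) (p j) ↔ j.val = n - 1) ∧
    (∀ (i : Fin (k - 2)) (j : Fin (m i)), ¬ G.Adj (x ⟨k - 1, by omega⟩) (ℓ i j)) ∧
    (∀ (i : Fin (k - 2)) (j : Fin n),
      ¬ G.Adj (x ⟨i.val + 1, by have := i.isLt; omega⟩) (p j)) ∧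
    (∀ (i i' : Fin (k - 2)) (j : Fin (m i')),
      G.Adj (x ⟨i.val + 1, by have := i.isLt; omega⟩) (ℓ i' j) ↔ (i' = i ∧ j.val = m i' - 1))

/-- `(H, x)` is a triangular connectifier: `H` is the line graph of a caterpillar, with
spine `p` and legs `ℓ` attached along triangles, and `x` enumerates `X` in the order given
by the connectifier. -/
def IsTriangularConnectifier {α : Type} (G : SimpleGraph α) (H : Set α)
    (k : ℕ) (x : Fin k → α) : Prop :=
  ∃ (hk : 2 ≤ k) (n : ℕ) (_ : 2 ≤ n) (p : Fin n → α)
    (m : Fin (k - 2) → ℕ) (ℓ : ∀ i, Fin (m i) → α) (a : Fin (k - 2) → ℕ),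
    IsPathEmb G n p ∧ (∀ i, 1 ≤ m i) ∧ (∀ i, IsPathEmb G (m i) (ℓ i)) ∧
    H = Set.range p ∪ ⋃ i, Set.range (ℓ i) ∧
    Function.Injective x ∧ (∀ i, x i ∉ H) ∧
    (∀ i j j', ℓ i j ≠ p j') ∧
    (∀ i i', i ≠ i' → ∀ j j', ℓ i j ≠ ℓ i' j' ∧ ¬ G.Adj (ℓ i j) (ℓ i' j')) ∧
    (∀ i, a i + 1 ≤ n - 1) ∧
    (∀ i i', i < i' → a i < a i') ∧
    (∀ (i : Fin (k - 2)) (j : Fin (m i)) (j' : Fin n),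
      G.Adj (ℓ i j) (p j') ↔ (j.val = 0 ∧ (j'.val = a i ∨ j'.val = a i + 1))) ∧
    (∀ j : Fin n, G.Adj (x ⟨0, by omega⟩) (p j) ↔ j.val = 0) ∧
    (∀ (i : Fin (k - 2)) (j : Fin (m i)), ¬ G.Adj (x ⟨0, by omega⟩) (ℓ i j)) ∧
    (∀ j : Fin n, G.Adj (x ⟨k - 1, by omega⟩) (p j) ↔ j.val = n - 1) ∧
    (∀ (i : Fin (k - 2)) (j : Fin (m i)), ¬ G.Adj (x ⟨k - 1, by omega⟩) (ℓ i j)) ∧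
    (∀ (i : Fin (k - 2)) (j : Fin n),
      ¬ G.Adj (x ⟨i.val + 1, by have := i.isLt; omega⟩) (p j)) ∧
    (∀ (i i' : Fin (k - 2)) (j : Fin (m i')),
      G.Adj (x ⟨i.val + 1, by have := i.isLt; omega⟩) (ℓ i' j) ↔ (i' = i ∧ j.val = m i' - 1))

/-- `(H, x)` is a stellar connectifier: `H` is an induced subdivided star with root `r` and
legs `ℓ`, and the vertices of `X` are attached to the tips of the legs. -/
def IsStellarConnectifier {α : Type} (G : SimpleGraph α) (H : Set α)
    (k : ℕ) (x : Fin k → α) : Prop :=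
  ∃ (_ : 3 ≤ k) (r : α) (m : Fin k → ℕ) (ℓ : ∀ i, Fin (m i) → α),
    (∀ i, 1 ≤ m i) ∧ (∀ i, IsPathEmb G (m i) (ℓ i)) ∧
    H = {r} ∪ ⋃ i, Set.range (ℓ i) ∧
    Function.Injective x ∧ (∀ i, x i ∉ H) ∧
    (∀ i j, ℓ i j ≠ r) ∧
    (∀ i i', i ≠ i' → ∀ j j', ℓ i j ≠ ℓ i' j' ∧ ¬ G.Adj (ℓ i j) (ℓ i' j')) ∧
    (∀ (i : Fin k) (j : Fin (m i)), G.Adj r (ℓ i j) ↔ j.val = 0) ∧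
    (∀ i, ¬ G.Adj (x i) r) ∧
    (∀ (i i' : Fin k) (j : Fin (m i')),
      G.Adj (x i) (ℓ i' j) ↔ (i' = i ∧ j.val = m i' - 1))

/-- `(H, X)` is a wide alignment (set version). -/
def IsWideAlignSet {α : Type} (G : SimpleGraph α) (H X : Set α) : Prop :=
  ∃ (n k : ℕ) (p : Fin n → α) (e : Fin k → α),
    H = Set.range p ∧ X = Set.range e ∧ IsWideAlignment G n p k e

/-- `(H, X)` is a spiky alignment (set version). -/
def IsSpikyAlignSet {α : Type} (G : SimpleGraph α) (H X : Set α) : Prop :=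
  ∃ (n k : ℕ) (p : Fin n → α) (e : Fin k → α),
    H = Set.range p ∧ X = Set.range e ∧ IsSpikyAlignment G n p k e

/-- `(H, X)` is a triangular alignment (set version). -/
def IsTriAlignSet {α : Type} (G : SimpleGraph α) (H X : Set α) : Prop :=
  ∃ (n k : ℕ) (p : Fin n → α) (e : Fin k → α),
    H = Set.range p ∧ X = Set.range e ∧ IsTriangularAlignment G n p k e

/-- `(H, X)` is a spiky connectifier (set version). -/
def IsSpikyConnSet {α : Type} (G : SimpleGraph α) (H X : Set α) : Prop :=
  ∃ (k : ℕ) (e : Fin k → α), X = Set.range e ∧ IsSpikyConnectifier G H k e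

/-- `(H, X)` is a triangular connectifier (set version). -/
def IsTriConnSet {α : Type} (G : SimpleGraph α) (H X : Set α) : Prop :=
  ∃ (k : ℕ) (e : Fin k → α), X = Set.range e ∧ IsTriangularConnectifier G H k e

/-- `(H, X)` is a stellar connectifier (set version). -/
def IsStellarConnSet {α : Type} (G : SimpleGraph α) (H X : Set α) : Prop :=
  ∃ (k : ℕ) (e : Fin k → α), X = Set.range e ∧ IsStellarConnectifier G H k e

/-- `(H, X)` (with order `e` on `X`) is a consistent alignment or consistent connectifier. -/
def IsConsistentWith {α : Type} (G : SimpleGraph α) (H : Set α)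
    (k : ℕ) (e : Fin k → α) : Prop :=
  (∃ (n : ℕ) (p : Fin n → α), H = Set.range p ∧
    (IsWideAlignment G n p k e ∨ IsSpikyAlignment G n p k e ∨ IsTriangularAlignment G n p k e)) ∨
  IsSpikyConnectifier G H k e ∨ IsTriangularConnectifier G H k e ∨
    IsStellarConnectifier G H k e

/-- `(P, Q)` is a separation of `G`. -/
def IsSeparation {α : Type} (G : SimpleGraph α) (P Q : Set α) : Prop :=
  P ∪ Q = univ ∧ ∀ a b, a ∈ P → a ∉ Q → b ∈ Q → b ∉ P → ¬ G.Adj a b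

theorem IsSeparation.symm {α : Type} {G : SimpleGraph α} {P Q : Set α}
    (h : IsSeparation G P Q) : IsSeparation G Q P :=
  ⟨by rw [union_comm]; exact h.1, fun a b ha ha' hb hb' hab => h.2 b a hb hb' ha ha' hab.symm⟩

theorem IsSeparation.mem_or {α : Type} {G : SimpleGraph α} {P Q : Set α}
    (h : IsSeparation G P Q) (x : α) : x ∈ P ∨ x ∈ Q := by
  have : x ∈ P ∪ Q := h.1 ▸ mem_univ x
  exact this

theorem IsSeparation.adj_mem_or {α : Type} {G : SimpleGraph α} {P Q : Set α}
    (h : IsSeparation G P Q) {a b : α} (hab : G.Adj a b) : (a ∈ P ∧ b ∈ P) ∨ (a ∈ Q ∧ b ∈ Q) := by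
  have ha := h.mem_or a
  have hb := h.mem_or b
  have h1 := h.2 a b
  have h2 := h.2 b a
  have := hab.symm
  tauto

/-- A connected set meeting both `F` and its complement contains an edge leaving `F`. -/
theorem exists_adj_leaving {α : Type} {G : SimpleGraph α} {A F : Set α}
    (hA : (G.induce A).Preconnected) {p q : α} (hp : p ∈ A) (hq : q ∈ A) (hpF : p ∈ F)
    (hqF : q ∉ F) : ∃ a ∈ A, ∃ b ∈ A, a ∈ F ∧ b ∉ F ∧ G.Adj a b := by
  obtain ⟨w⟩ := hA ⟨p, hp⟩ ⟨q, hq⟩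
  obtain ⟨d, -, hd1, hd2⟩ := w.exists_boundary_dart (Subtype.val ⁻¹' F) hpF hqF
  exact ⟨d.fst, d.fst.2, d.snd, d.snd.2, hd1, hd2, d.adj⟩

theorem connSet_mono {α : Type} {G G' : SimpleGraph α} (h : G ≤ G') {A : Set α}
    (hA : ConnSet G A) : ConnSet G' A :=
  SimpleGraph.Connected.mono (fun _ _ hab => h hab) hA

/-- If all edges of `G` lie within `P`, then so does every connected set meeting `P`. -/
theorem ConnSet.subset_of_support {α : Type} {G : SimpleGraph α} {C P : Set α}
    (hC : ConnSet G C) (hG : ∀ a b, G.Adj a b → a ∈ P ∧ b ∈ P) (hCP : (C ∩ P).Nonempty) :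
    C ⊆ P := by
  obtain ⟨a, haC, haP⟩ := hCP
  intro z hz
  by_contra hzP
  obtain ⟨x, -, y, -, -, hy, hxy⟩ := exists_adj_leaving hC.preconnected haC hz haP hzP
  exact hy (hG _ _ hxy).2

/-- Every separation separating `A` from `B` has order at least `k`. -/
def LinkCond {α : Type} (G : SimpleGraph α) (A B : Set α) (k : ℕ) : Prop :=
  ∀ P Q : Set α, A ⊆ P → B ⊆ Q → IsSeparation G P Q → k ≤ (P ∩ Q).ncard

theorem LinkCond.symm {α : Type} {G : SimpleGraph α} {A B : Set α} {k : ℕ}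
    (h : LinkCond G A B k) : LinkCond G B A k := fun P Q hP hQ hs => by
  rw [inter_comm]; exact h Q P hQ hP hs.symm

/-- There are `k` pairwise disjoint connected sets, each meeting `A` and `B`. -/
def Linked {α : Type} (G : SimpleGraph α) (A B : Set α) (k : ℕ) : Prop :=
  ∃ C : Fin k → Set α, (∀ i, ConnSet G (C i)) ∧ (∀ i, (C i ∩ A).Nonempty) ∧
    (∀ i, (C i ∩ B).Nonempty) ∧ ∀ i j, i ≠ j → Disjoint (C i) (C j)

/-- Disjoint connected sets linking `A` to a set `S` of the same number of vertices may be
indexed by the elements of `S`. -/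
theorem Linked.indexed {α : Type} [Finite α] {G : SimpleGraph α} {A S : Set α} {k : ℕ}
    (h : Linked G A S k) (hS : S.ncard = k) :
    ∃ C : α → Set α, (∀ s ∈ S, ConnSet G (C s) ∧ (C s ∩ A).Nonempty ∧ s ∈ C s) ∧
      ∀ s ∈ S, ∀ s' ∈ S, s ≠ s' → Disjoint (C s) (C s') := by
  obtain ⟨C, hC, hA, hB, hd⟩ := h
  choose f hf using hB
  have hinj : Function.Injective f := fun i j hij => by
    by_contra hne
    exact disjoint_left.1 (hd i j hne) (hf i).1 (hij ▸ (hf j).1)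
  have hrange : range f = S := by
    apply eq_of_subset_of_ncard_le (range_subset_iff.2 fun i => (hf i).2)
    rw [hS, ← image_univ, ncard_image_of_injective _ hinj, ncard_univ, Nat.card_fin]
  have hex : ∀ s ∈ S, ∃ i, f i = s := fun s hs => by rw [← hrange] at hs; exact hs
  classical
  refine ⟨fun s => if hs : s ∈ S then C (hex s hs).choose else ∅, fun s hs => ?_,
    fun s hs s' hs' hne => ?_⟩
  · simp only [hs, dif_pos]
    refine ⟨hC _, hA _, ?_⟩
    have := (hf (hex s hs).choose).1
    rwa [(hex s hs).choose_spec] at this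
  · simp only [hs, hs', dif_pos]
    apply hd
    intro he
    apply hne
    rw [← (hex s hs).choose_spec, ← (hex s' hs').choose_spec, he]

/-- The subgraph of `G` consisting of the edges with both ends in `P`. -/
def restrictTo {α : Type} (G : SimpleGraph α) (P : Set α) : SimpleGraph α where
  Adj a b := G.Adj a b ∧ a ∈ P ∧ b ∈ P
  symm := ⟨fun _ _ h => ⟨h.1.symm, h.2.2, h.2.1⟩⟩
  loopless := ⟨fun _ h => h.1.ne rfl⟩

theorem restrictTo_le {α : Type} (G : SimpleGraph α) (P : Set α) : restrictTo G P ≤ G :=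
  fun _ _ h => h.1

/-- If `(P, Q)` becomes a separation by deleting the edge `xy`, with `x` in `P \ Q`, then the
linkage condition is inherited by the part of `G` on `P`. -/
theorem LinkCond.restrict {α : Type} [Finite α] {G : SimpleGraph α} {A B P Q : Set α} {k : ℕ}
    {x y : α} (h : LinkCond G A B k) (hA : A ⊆ P) (hB : B ⊆ Q) (hPQ : P ∪ Q = univ)
    (hsep : ∀ a b, a ∈ P → a ∉ Q → b ∈ Q → b ∉ P → G.Adj a b → a = x ∧ b = y) :
    LinkCond (restrictTo G P) A (insert x (P ∩ Q)) k := by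
  intro P1 Q1 hP1 hQ1 hs
  have hu : ∀ z, z ∈ P ∨ z ∈ Q := fun z => by
    have : z ∈ P ∪ Q := hPQ ▸ mem_univ z
    exact this
  have hQ1' : ∀ z, z ∈ P → z ∈ Q → z ∈ Q1 := fun z h1 h2 => hQ1 (Or.inr ⟨h1, h2⟩)
  have hx : x ∈ Q1 := hQ1 (Or.inl rfl)
  refine le_trans (h (P1 ∩ P) ((Q1 ∩ P) ∪ Q) (fun a ha => ⟨hP1 ha, hA ha⟩)
    (fun b hb => Or.inr (hB hb)) ⟨?_, ?_⟩) (ncard_le_ncard ?_ (toFinite _))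
  · ext z
    have := hs.mem_or z
    have := hu z
    simp only [mem_union, mem_inter_iff, mem_univ, iff_true]
    tauto
  · rintro a b ⟨ha1, ha2⟩ ha3 hb hb' hab
    have haQ1 : a ∉ Q1 := fun h => ha3 (Or.inl ⟨h, ha2⟩)
    have haQ : a ∉ Q := fun h => ha3 (Or.inr h)
    by_cases hbP : b ∈ P
    · have hbP1 : b ∉ P1 := fun h => hb' ⟨h, hbP⟩
      have hbQ1 : b ∈ Q1 := (hs.mem_or b).resolve_left hbP1
      exact hs.2 a b ha1 haQ1 hbQ1 hbP1 ⟨hab, ha2, hbP⟩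
    · have hbQ : b ∈ Q := (hu b).resolve_left hbP
      obtain ⟨rfl, -⟩ := hsep a b ha2 haQ hbQ hbP hab
      exact haQ1 hx
  · rintro z ⟨⟨hz1, hz2⟩, hz3 | hz3⟩
    · exact ⟨hz1, hz3.1⟩
    · exact ⟨hz1, hQ1' z hz2 hz3⟩

theorem linked_bot {α : Type} [Finite α] {A B : Set α} {k : ℕ}
    (h : LinkCond (⊥ : SimpleGraph α) A B k) : Linked (⊥ : SimpleGraph α) A B k := by
  have h1 : k ≤ (A ∩ B).ncard := by
    have := h A (Aᶜ ∪ B) le_rfl subset_union_right ⟨by ext; simp; tauto, by simp⟩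
    rwa [inter_union_distrib_left, inter_compl_self, empty_union] at this
  obtain ⟨S, hS, hSk⟩ := exists_subset_card_eq h1
  have e : Fin k ≃ S := (Finite.equivFinOfCardEq hSk).symm
  refine ⟨fun i => {(e i : α)}, fun i => ?_, fun i => ⟨e i, rfl, (hS (e i).2).1⟩,
    fun i => ⟨e i, rfl, (hS (e i).2).2⟩, fun i j hij => ?_⟩
  · have : Nonempty ({(e i : α)} : Set α) := ⟨⟨_, rfl⟩⟩
    exact ⟨SimpleGraph.Preconnected.of_subsingleton⟩
  · simp only [disjoint_singleton, ne_eq, Subtype.coe_inj, e.apply_eq_iff_eq]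
    exact hij

/-- Combining linkages of the two sides of a separation of `G` minus the edge `xy`. -/
theorem linked_glue {α : Type} [Finite α] {G : SimpleGraph α} {A B P Q : Set α} {k : ℕ}
    {x y : α} (hA : A ⊆ P) (hB : B ⊆ Q) (hxP : x ∈ P) (hxQ : x ∉ Q) (hyP : y ∉ P)
    (hxy : G.Adj x y) (hk : (P ∩ Q).ncard + 1 = k)
    (h1 : Linked (restrictTo G P) A (insert x (P ∩ Q)) k)
    (h2 : Linked (restrictTo G Q) B (insert y (P ∩ Q)) k) : Linked G A B k := by
  have hxS : x ∉ P ∩ Q := fun h => hxQ h.2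
  have hyS : y ∉ P ∩ Q := fun h => hyP h.1
  have hcard : (insert x (P ∩ Q)).ncard = k := by
    rw [ncard_insert_of_notMem hxS (toFinite _), hk]
  obtain ⟨C, hC, hCd⟩ := h1.indexed hcard
  obtain ⟨D, hD, hDd⟩ := h2.indexed (by rw [ncard_insert_of_notMem hyS (toFinite _), hk])
  have hCP : ∀ s ∈ insert x (P ∩ Q), C s ⊆ P := fun s hs =>
    (hC s hs).1.subset_of_support (fun _ _ h => h.2)
      ((hC s hs).2.1.mono (inter_subset_inter_right _ hA))
  have hDQ : ∀ s ∈ insert y (P ∩ Q), D s ⊆ Q := fun s hs =>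
    (hD s hs).1.subset_of_support (fun _ _ h => h.2)
      ((hD s hs).2.1.mono (inter_subset_inter_right _ hB))
  classical
  have hex : ∃ σ : α → α, σ x = y ∧ (∀ s ∈ P ∩ Q, σ s = s) :=
    ⟨fun s => if s = x then y else s, if_pos rfl, fun s hs => if_neg fun h : s = x => hxS (h ▸ hs)⟩
  obtain ⟨σ, hσx, hσ⟩ := hex
  have hσmem : ∀ s ∈ insert x (P ∩ Q), σ s ∈ insert y (P ∩ Q) := by
    rintro s (rfl | hs)
    · exact Or.inl hσx
    · rw [hσ s hs]; exact Or.inr hs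
  have hσinj : ∀ s ∈ insert x (P ∩ Q), ∀ s' ∈ insert x (P ∩ Q), σ s = σ s' → s = s' := by
    rintro s (rfl | hs) s' (rfl | hs') h
    · rfl
    · rw [hσx, hσ s' hs'] at h; exact absurd (h ▸ hs') hyS
    · rw [hσx, hσ s hs] at h; exact absurd (h ▸ hs) hyS
    · rwa [hσ s hs, hσ s' hs'] at h
  have hcross : ∀ s ∈ insert x (P ∩ Q), ∀ s' ∈ insert x (P ∩ Q), s ≠ s' →
      Disjoint (C s) (D (σ s')) := by
    intro s hs s' hs' hne
    rw [disjoint_left]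
    intro z hz hz'
    have hzS : z ∈ P ∩ Q := ⟨hCP s hs hz, hDQ _ (hσmem s' hs') hz'⟩
    have hzs : z = s := by
      by_contra h
      exact disjoint_left.1 (hCd z (Or.inr hzS) s hs h) (hC z (Or.inr hzS)).2.2 hz
    have hzs' : z = σ s' := by
      by_contra h
      exact disjoint_left.1 (hDd z (Or.inr hzS) _ (hσmem s' hs') h) (hD z (Or.inr hzS)).2.2 hz'
    apply hne
    apply hσinj s hs s' hs'
    rw [← hzs', ← hzs, hσ z hzS]
  have e : Fin k ≃ (insert x (P ∩ Q) : Set α) := (Finite.equivFinOfCardEq hcard).symm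
  refine ⟨fun i => C (e i) ∪ D (σ (e i)), fun i => ?_, fun i => ?_, fun i => ?_,
    fun i j hij => ?_⟩
  · have c1 := connSet_mono (restrictTo_le G P) (hC _ (e i).2).1
    have c2 := connSet_mono (restrictTo_le G Q) (hD _ (hσmem _ (e i).2)).1
    rcases (e i).2 with h | h
    · refine SimpleGraph.connected_induce_union c1.preconnected c2.preconnected
        (hC _ (e i).2).2.2 (hD _ (hσmem _ (e i).2)).2.2 ?_
      rw [h, hσx]; exact hxy
    · refine SimpleGraph.induce_union_connected c1.preconnected c2.preconnected
        ⟨_, (hC _ (e i).2).2.2, ?_⟩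
      have := (hD _ (hσmem _ (e i).2)).2.2
      rwa [hσ _ h] at this ⊢
  · exact (hC _ (e i).2).2.1.mono (inter_subset_inter_left _ subset_union_left)
  · exact (hD _ (hσmem _ (e i).2)).2.1.mono (inter_subset_inter_left _ subset_union_right)
  · have hne : (e i : α) ≠ e j := fun h => hij (e.injective (Subtype.ext h))
    rw [disjoint_union_left, disjoint_union_right, disjoint_union_right]
    exact ⟨⟨hCd _ (e i).2 _ (e j).2 hne, hcross _ (e i).2 _ (e j).2 hne⟩,
      (hcross _ (e j).2 _ (e i).2 hne.symm).symm,
      hDd _ (hσmem _ (e i).2) _ (hσmem _ (e j).2) fun h => hne (hσinj _ (e i).2 _ (e j).2 h)⟩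

/-- Menger's theorem, with connected sets in place of paths. -/
theorem LinkCond.linked {α : Type} [Finite α] (G : SimpleGraph α) :
    ∀ {A B : Set α} {k : ℕ}, LinkCond G A B k → Linked G A B k := by
  induction G using WellFoundedLT.induction with
  | ind G ih =>
  intro A B k h
  by_cases hbot : G = ⊥
  · subst hbot; exact linked_bot h
  obtain ⟨x, y, hxy⟩ := SimpleGraph.ne_bot_iff_exists_adj.1 hbot
  have hlt : G.deleteEdges {s(x, y)} < G := by
    refine lt_of_le_of_ne (SimpleGraph.deleteEdges_le _) fun he => ?_
    rw [← he] at hxy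
    simp at hxy
  by_cases hdel : LinkCond (G.deleteEdges {s(x, y)}) A B k
  · obtain ⟨C, hC, hr⟩ := ih _ hlt hdel
    exact ⟨C, fun i => connSet_mono hlt.le (hC i), hr⟩
  unfold LinkCond at hdel
  push Not at hdel
  obtain ⟨P, Q, hA, hB, hs, hlt'⟩ := hdel
  have key : ∀ x y : α, G.Adj x y → x ∈ P → x ∉ Q → y ∈ Q → y ∉ P →
      (∀ a b, a ∈ P → a ∉ Q → b ∈ Q → b ∉ P → G.Adj a b → a = x ∧ b = y) → Linked G A B k := by
    intro x y hxy hxP hxQ hyQ hyP hsep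
    have hk : (P ∩ Q).ncard + 1 = k := by
      have : k ≤ (P ∩ insert x Q).ncard := by
        refine h P (insert x Q) hA (hB.trans (subset_insert _ _))
          ⟨by rw [union_insert, hs.1]; simp, fun a b ha ha' hb hb' hab => ?_⟩
        have haQ : a ∉ Q := fun h => ha' (Or.inr h)
        rcases hb with rfl | hb
        · exact hb' hxP
        · exact ha' (Or.inl (hsep a b ha haQ hb hb' hab).1)
      have h2 : P ∩ insert x Q ⊆ insert x (P ∩ Q) := by
        rintro z ⟨h1, rfl | h2⟩
        · exact Or.inl rfl
        · exact Or.inr ⟨h1, h2⟩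
      have h3 := ncard_le_ncard h2 (toFinite _)
      have h4 := ncard_insert_le x (P ∩ Q)
      omega
    have hltP : restrictTo G P < G :=
      lt_of_le_of_ne (restrictTo_le G P) fun he => by
        rw [← he] at hxy; exact hyP hxy.2.2
    have hltQ : restrictTo G Q < G :=
      lt_of_le_of_ne (restrictTo_le G Q) fun he => by
        rw [← he] at hxy; exact hxQ hxy.2.1
    refine linked_glue hA hB hxP hxQ hyP hxy hk (ih _ hltP (h.restrict hA hB hs.1 hsep))
      (ih _ hltQ ?_)
    rw [inter_comm P Q]
    exact h.symm.restrict hB hA hs.symm.1 fun a b ha ha' hb hb' hab =>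
      (hsep b a hb hb' ha ha' hab.symm).symm
  have hedge : ∀ a b, a ∈ P → a ∉ Q → b ∈ Q → b ∉ P → G.Adj a b → s(a, b) = s(x, y) := by
    intro a b ha ha' hb hb' hab
    by_contra hne
    exact hs.2 a b ha ha' hb hb' (by rw [SimpleGraph.deleteEdges_adj]; exact ⟨hab, hne⟩)
  have hno : ∃ a b, a ∈ P ∧ a ∉ Q ∧ b ∈ Q ∧ b ∉ P ∧ G.Adj a b := by
    by_contra hcon
    push Not at hcon
    exact absurd (h P Q hA hB ⟨hs.1, hcon⟩) (not_le.2 hlt')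
  obtain ⟨a, b, ha, ha', hb, hb', hab⟩ := hno
  refine key a b hab ha ha' hb hb' fun a2 b2 h1 h2 h3 h4 h5 => ?_
  have e1 := hedge a b ha ha' hb hb' hab
  rw [← hedge a2 b2 h1 h2 h3 h4 h5, Sym2.eq_iff] at e1
  rcases e1 with ⟨rfl, rfl⟩ | ⟨rfl, rfl⟩
  · exact ⟨rfl, rfl⟩
  · exact absurd hb h2

/-- A connected graph contains an induced path between any two vertices. -/
theorem exists_isPathFromTo {α : Type} {G : SimpleGraph α} {u v : α} (h : G.Reachable u v) :
    ∃ (n : ℕ) (f : Fin n → α), IsPathFromTo G n f u v := by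
  obtain ⟨p, hp⟩ := h.exists_walk_length_eq_dist
  have hdist : ∀ i, i ≤ p.length → G.dist u (p.getVert i) = i := by
    intro i hi
    have h1 : G.dist u (p.getVert i) ≤ i :=
      (SimpleGraph.dist_le (p.take i)).trans (by simp)
    have h2 : G.dist (p.getVert i) v ≤ p.length - i :=
      (SimpleGraph.dist_le (p.drop i)).trans (by simp)
    have h3 : p.length ≤ G.dist u (p.getVert i) + G.dist (p.getVert i) v := by
      rw [hp]
      exact SimpleGraph.Reachable.dist_triangle_left ⟨p.take i⟩ v
    omega
  have hstep : ∀ i j, i ≤ p.length → j ≤ p.length → G.Adj (p.getVert i) (p.getVert j) →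
      j ≤ i + 1 := by
    intro i j hi hj hadj
    have := SimpleGraph.Reachable.dist_triangle_left (w := p.getVert j) ⟨p.take i⟩
    rw [hdist i hi, hdist j hj, SimpleGraph.dist_eq_one_iff_adj.2 hadj] at this
    exact this
  refine ⟨p.length + 1, fun i => p.getVert i, ⟨fun i j hij => ?_, fun i j => ⟨fun hadj => ?_, ?_⟩⟩,
    by omega, by simp, by simp⟩
  · have h1 := hdist i (by omega)
    have h2 := hdist j (by omega)
    have hij' : p.getVert i = p.getVert j := hij
    rw [hij', h2] at h1
    exact Fin.ext h1.symm
  · have h1 := hstep i j (by omega) (by omega) hadj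
    have h2 := hstep j i (by omega) (by omega) hadj.symm
    have h3 : i.val ≠ j.val := fun h => hadj.ne (congrArg p.getVert h)
    omega
  · change _ → G.Adj (p.getVert i) (p.getVert j)
    rintro (h | h)
    · rw [h]; exact (p.adj_getVert_succ (by omega)).symm
    · rw [h]; exact p.adj_getVert_succ (by omega)

theorem IsPathEmb.map {α β : Type} {G : SimpleGraph α} {G' : SimpleGraph β} (φ : G ↪g G') {n : ℕ}
    {f : Fin n → α} (h : IsPathEmb G n f) : IsPathEmb G' n (φ ∘ f) :=
  ⟨φ.injective.comp h.1, fun i j => by simpa using h.2 i j⟩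

theorem IsPathFromTo.map {α β : Type} {G : SimpleGraph α} {G' : SimpleGraph β} (φ : G ↪g G')
    {n : ℕ} {f : Fin n → α} {a b : α} (h : IsPathFromTo G n f a b) :
    IsPathFromTo G' n (φ ∘ f) (φ a) (φ b) := by
  obtain ⟨h1, h2, h3, h4⟩ := h
  exact ⟨h1.map φ, h2, congrArg φ h3, congrArg φ h4⟩

theorem IsHole.map {α β : Type} {G : SimpleGraph α} {G' : SimpleGraph β} (φ : G ↪g G')
    {H : Set α} (h : IsHole G H) : IsHole G' (φ '' H) := by
  obtain ⟨n, f, hn, ⟨h1, h2⟩, rfl⟩ := h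
  exact ⟨n, φ ∘ f, hn, ⟨φ.injective.comp h1, fun i j => by simpa using h2 i j⟩, range_comp _ _⟩

theorem holeNbrs_image {α β : Type} {G : SimpleGraph α} {G' : SimpleGraph β} (φ : G ↪g G')
    (H : Set α) (x : α) : holeNbrs G' (φ '' H) (φ x) = φ '' holeNbrs G H x := by
  ext z
  constructor
  · rintro ⟨⟨y, hy, rfl⟩, hz⟩
    exact ⟨y, ⟨hy, by simpa using hz⟩, rfl⟩
  · rintro ⟨y, ⟨hy, hxy⟩, rfl⟩
    exact ⟨⟨y, hy, rfl⟩, by simpa using hxy⟩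

theorem ncard_holeNbrs_image {α β : Type} {G : SimpleGraph α} {G' : SimpleGraph β} (φ : G ↪g G')
    (H : Set α) (x : α) : (holeNbrs G' (φ '' H) (φ x)).ncard = (holeNbrs G H x).ncard := by
  rw [holeNbrs_image, ncard_image_of_injective _ φ.injective]

theorem isWheel_image {α β : Type} {G : SimpleGraph α} {G' : SimpleGraph β} (φ : G ↪g G')
    {H : Set α} {x : α} (h : IsWheel G H x) : IsWheel G' (φ '' H) (φ x) :=
  ⟨h.1.map φ, fun ⟨y, hy, hyx⟩ => h.2.1 (φ.injective hyx ▸ hy), by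
    rw [ncard_holeNbrs_image]; exact h.2.2⟩

theorem exists_triple_of_image {α β : Type} {G : SimpleGraph α} {G' : SimpleGraph β} (φ : G ↪g G')
    {H : Set α} {x : α} {p q r : β} (h : holeNbrs G' (φ '' H) (φ x) = {p, q, r}) :
    ∃ p' q' r', φ p' = p ∧ φ q' = q ∧ φ r' = r ∧ holeNbrs G H x = {p', q', r'} := by
  rw [holeNbrs_image] at h
  obtain ⟨p', -, rfl⟩ : p ∈ φ '' holeNbrs G H x := by rw [h]; simp
  obtain ⟨q', -, rfl⟩ : q ∈ φ '' holeNbrs G H x := by rw [h]; simp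
  obtain ⟨r', -, rfl⟩ : r ∈ φ '' holeNbrs G H x := by rw [h]; simp
  refine ⟨p', q', r', rfl, rfl, rfl, φ.injective.image_injective ?_⟩
  rw [h, image_insert_eq, image_insert_eq, image_singleton]

theorem IsHub.map {α β : Type} {G : SimpleGraph α} {G' : SimpleGraph β} (φ : G ↪g G')
    {x : α} (h : IsHub G x) : IsHub G' (φ x) := by
  obtain ⟨H, hw, ht, hp⟩ := h
  refine ⟨φ '' H, isWheel_image φ hw, ?_, ?_⟩
  · rintro ⟨-, p, q, r, h1, h2, h3, he, h4, h5, h6⟩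
    obtain ⟨p, q, r, rfl, rfl, rfl, he'⟩ := exists_triple_of_image φ he
    refine ht ⟨hw, p, q, r, fun h => h1 (congrArg φ h), fun h => h2 (congrArg φ h),
      fun h => h3 (congrArg φ h), he', ?_, ?_, ?_⟩ <;> simp_all
  · rintro ⟨-, p, q, r, h1, h2, h3, he, h4, h5, h6⟩
    obtain ⟨p, q, r, rfl, rfl, rfl, he'⟩ := exists_triple_of_image φ he
    refine hp ⟨hw, p, q, r, fun h => h1 (congrArg φ h), fun h => h2 (congrArg φ h),
      fun h => h3 (congrArg φ h), he', ?_, ?_, ?_⟩ <;> simp_all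

/-- The class `𝒞ₜ` is closed under induced subgraphs. -/
theorem MemCt.of_embedding {α β : Type} {G : SimpleGraph α} {G' : SimpleGraph β} (φ : G ↪g G')
    {t : ℕ} (h : MemCt t G') : MemCt t G := by
  obtain ⟨⟨h4, hth, hpr, hev⟩, hcl⟩ := h
  refine ⟨⟨fun H hH hc => ?_, ?_, ?_, fun H x hw he => ?_⟩, hcl.comap ⟨φ.toCopy⟩⟩
  · exact h4 _ (hH.map φ) (by rw [ncard_image_of_injective _ φ.injective, hc])
  · rintro ⟨a, b, n, f, h1, h2, h3, h5, h6⟩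
    refine hth ⟨φ a, φ b, n, fun i => φ ∘ f i, φ.injective.ne h1, by simpa using h2, h3,
      fun i => (h5 i).map φ, fun i j hij u v hu hu' hv hv' => ?_⟩
    have := h6 i j hij u v hu hu' hv hv'
    exact ⟨φ.injective.ne this.1, by simpa using this.2⟩
  · rintro ⟨n, f, h1, h2, h3, h5⟩
    exact hpr ⟨n, fun i => φ ∘ f i, h1, fun i => (h2 i).map φ,
      fun i j hij u v => φ.injective.ne (h3 i j hij u v),
      fun i j hij u v => by simpa using h5 i j hij u v⟩
  · exact hev _ _ (isWheel_image φ hw) (by rwa [ncard_holeNbrs_image])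

/-- If `u` and `v` are not separated in `G` by any set of size less than `k + |H|`, then there
are `k` internally disjoint paths from `u` to `v` avoiding `H`. -/
theorem kDisjointPaths_of_separations {α : Type} [Finite α] {G : SimpleGraph α} {H : Set α} {k : ℕ}
    {u v : α} (huv : u ≠ v) (hadj : ¬ G.Adj u v) (hu : u ∉ H) (hv : v ∉ H)
    (hsep : ∀ P Q, IsSeparation G P Q → u ∈ P → u ∉ Q → v ∈ Q → v ∉ P →
      k + H.ncard ≤ (P ∩ Q).ncard) :
    KDisjointPaths (G.induce Hᶜ) k ⟨u, hu⟩ ⟨v, hv⟩ := by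
  set R : Set α := {w | w ∉ H ∧ w ≠ u ∧ w ≠ v} with hR
  have hcond : LinkCond (restrictTo G R) {w | G.Adj u w ∧ w ∉ H} {w | G.Adj v w ∧ w ∉ H} k := by
    intro P Q hP hQ hs
    have := hsep (insert u ((P ∪ H) \ {v})) (insert v ((Q ∪ H) \ {u})) ⟨?_, ?_⟩ (Or.inl rfl)
      (by simp [huv]) (Or.inl rfl) (by simp [huv.symm])
    · have h1 : insert u ((P ∪ H) \ {v}) ∩ insert v ((Q ∪ H) \ {u}) ⊆ (P ∩ Q) ∪ H := by
        rintro z ⟨h1, h2⟩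
        simp only [mem_insert_iff, mem_sdiff, mem_union, mem_singleton_iff, mem_inter_iff] at *
        rcases h1 with rfl | h1
        · tauto
        · tauto
      have h2 := ncard_le_ncard h1 (toFinite _)
      have h3 := ncard_union_le (P ∩ Q) H
      omega
    · ext z
      have := hs.mem_or z
      simp only [mem_insert_iff, mem_sdiff, mem_union, mem_singleton_iff, mem_univ, iff_true]
      tauto
    · intro a b ha ha' hb hb' hab
      simp only [mem_insert_iff, mem_sdiff, mem_union, mem_singleton_iff, not_or, not_and,
        not_not] at ha ha' hb hb'
      have haH : a ∉ H := fun h => hu (ha'.2 (Or.inr h) ▸ h)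
      have hbH : b ∉ H := fun h => hv (hb'.2 (Or.inr h) ▸ h)
      by_cases hau : a = u
      · subst hau
        exact hadj (hb'.2 (Or.inl (hP ⟨hab, hbH⟩)) ▸ hab)
      by_cases hbv : b = v
      · subst hbv
        exact hau (ha'.2 (Or.inl (hQ ⟨hab.symm, haH⟩)))
      exact hs.2 a b (by tauto) (by tauto) (by tauto) (by tauto)
        ⟨hab, ⟨haH, hau, ha'.1⟩, hbH, hb'.1, hbv⟩
  obtain ⟨C, hC, hCA, hCB, hd⟩ := hcond.linked
  have hCR : ∀ i, C i ⊆ R := fun i => by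
    refine (hC i).subset_of_support (fun _ _ h => h.2) ?_
    obtain ⟨w, hw, hw1, hw2⟩ := hCA i
    exact ⟨w, hw, hw2, hw1.ne', fun h => hadj (h ▸ hw1)⟩
  have hpath : ∀ i, ∃ (n : ℕ) (f : Fin n → (Hᶜ : Set α)),
      IsPathFromTo (G.induce Hᶜ) n f ⟨u, hu⟩ ⟨v, hv⟩ ∧ ∀ x ∈ pathInterior n f, x.1 ∈ C i := by
    intro i
    obtain ⟨w, hw, hw1, -⟩ := hCA i
    obtain ⟨z, hz, hz1, -⟩ := hCB i
    have hsingle : ∀ y : α, (G.induce {y}).Preconnected := fun y =>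
      SimpleGraph.Preconnected.of_subsingleton
    have c1 : (G.induce ({u} ∪ C i)).Connected :=
      SimpleGraph.connected_induce_union (hsingle u)
        (connSet_mono (restrictTo_le G R) (hC i)).preconnected rfl hw hw1
    have c2 : (G.induce ({v} ∪ ({u} ∪ C i))).Connected :=
      SimpleGraph.connected_induce_union (hsingle v) c1.preconnected rfl (Or.inr hz) hz1
    have hsub : {v} ∪ ({u} ∪ C i) ≤ Hᶜ := by
      rintro y (rfl | rfl | hy)
      · exact hv
      · exact hu
      · exact (hCR i hy).1
    obtain ⟨n, f, hf⟩ := exists_isPathFromTo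
      (c2.preconnected ⟨u, Or.inr (Or.inl rfl)⟩ ⟨v, Or.inl rfl⟩)
    have hf' := hf.map (SimpleGraph.induceHomOfLE G hsub)
    refine ⟨n, _, hf', ?_⟩
    rintro x ⟨j, hj1, hj2, rfl⟩
    obtain ⟨⟨hinj, -⟩, hn, h0, h1⟩ := hf
    rcases (f j).2 with h | h | h
    · have : f j = f ⟨n - 1, by omega⟩ := by rw [h1]; exact Subtype.ext h
      have := congrArg Fin.val (hinj this)
      simp only at this
      omega
    · have : f j = f ⟨0, by omega⟩ := by rw [h0]; exact Subtype.ext h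
      have := congrArg Fin.val (hinj this)
      simp only at this
      omega
    · exact h
  choose n f hf hint using hpath
  refine ⟨n, f, hf, fun i j hij => ?_⟩
  rw [disjoint_left]
  intro x hx hx'
  exact disjoint_left.1 (hd i j hij) (hint i x hx) (hint j x hx')

/-- Two copies of `T`, joined by an edge between the copies of `r`. -/
def doubleGraph {ι : Type} (T : SimpleGraph ι) (r : ι) : SimpleGraph (ι ⊕ ι) :=
  SimpleGraph.sum T T ⊔ SimpleGraph.edge (.inl r) (.inr r)

theorem doubleGraph_adj_inl {ι : Type} {T : SimpleGraph ι} {r s s' : ι} :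
    (doubleGraph T r).Adj (.inl s) (.inl s') ↔ T.Adj s s' := by
  simp [doubleGraph, SimpleGraph.edge]

theorem doubleGraph_adj_inr {ι : Type} {T : SimpleGraph ι} {r s s' : ι} :
    (doubleGraph T r).Adj (.inr s) (.inr s') ↔ T.Adj s s' := by
  simp [doubleGraph, SimpleGraph.edge]

theorem doubleGraph_adj_inl_inr {ι : Type} {T : SimpleGraph ι} {r s s' : ι} :
    (doubleGraph T r).Adj (.inl s) (.inr s') ↔ s = r ∧ s' = r := by
  simp [doubleGraph, SimpleGraph.edge]

theorem isTree_doubleGraph {ι : Type} [Finite ι] {T : SimpleGraph ι} (hT : T.IsTree) (r : ι) :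
    (doubleGraph T r).IsTree := by
  refine SimpleGraph.isTree_iff_connected_and_card.2
    ⟨hT.connected.sum_sup_edge hT.connected, ?_⟩
  have hc := (SimpleGraph.isTree_iff_connected_and_card.1 hT).2
  have hne : (s(.inl r, .inr r) : Sym2 (ι ⊕ ι)) ∉ (T.sum T).edgeSet := by simp
  have hset : (doubleGraph T r).edgeSet =
      insert (s(.inl r, .inr r) : Sym2 (ι ⊕ ι)) (T.sum T).edgeSet := by
    rw [doubleGraph, SimpleGraph.edgeSet_sup, SimpleGraph.edgeSet_edge_of_ne Sum.inl_ne_inr,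
      union_singleton]
  rw [Nat.card_coe_set_eq, hset, ncard_insert_of_notMem hne (toFinite _),
    ← Nat.card_coe_set_eq, Nat.card_congr SimpleGraph.edgeSetSumEquiv, Nat.card_sum, Nat.card_sum]
  omega

theorem preconnected_induce_image {α β : Type} {G : SimpleGraph α} {G' : SimpleGraph β}
    (f : G →g G') {N : Set α} (h : (G.induce N).Preconnected) :
    (G'.induce (f '' N)).Preconnected := by
  rintro ⟨_, x, hx, rfl⟩ ⟨_, y, hy, rfl⟩
  exact (h ⟨x, hx⟩ ⟨y, hy⟩).map
    (⟨fun z => ⟨f z, z, z.2, rfl⟩, fun {a b} hab => f.map_rel hab⟩ :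
      G.induce N →g G'.induce (f '' N))

theorem isTD_double {V ι : Type} {G : SimpleGraph V} {T : SimpleGraph ι} [Finite ι]
    (hT : T.IsTree) (r : ι) {χ₁ χ₂ : ι → Set V}
    (hv : ∀ v, (∃ t, v ∈ χ₁ t) ∨ ∃ t, v ∈ χ₂ t)
    (he : ∀ u v, G.Adj u v → (∃ t, u ∈ χ₁ t ∧ v ∈ χ₁ t) ∨ ∃ t, u ∈ χ₂ t ∧ v ∈ χ₂ t)
    (h1 : ∀ v, (T.induce {t | v ∈ χ₁ t}).Preconnected)
    (h2 : ∀ v, (T.induce {t | v ∈ χ₂ t}).Preconnected)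
    (hr : ∀ v t t', v ∈ χ₁ t → v ∈ χ₂ t' → v ∈ χ₁ r ∧ v ∈ χ₂ r) :
    IsTD G (doubleGraph T r) (Sum.elim χ₁ χ₂) where
  finite := inferInstance
  isTree := isTree_doubleGraph hT r
  memBag v := by
    rcases hv v with ⟨t, ht⟩ | ⟨t, ht⟩
    · exact ⟨.inl t, ht⟩
    · exact ⟨.inr t, ht⟩
  edgeBag u v huv := by
    rcases he u v huv with ⟨t, ht⟩ | ⟨t, ht⟩
    · exact ⟨.inl t, ht⟩
    · exact ⟨.inr t, ht⟩
  subtree v := by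
    let f1 : T →g doubleGraph T r := ⟨Sum.inl, fun h => doubleGraph_adj_inl.2 h⟩
    let f2 : T →g doubleGraph T r := ⟨Sum.inr, fun h => doubleGraph_adj_inr.2 h⟩
    have hset : {t | v ∈ Sum.elim χ₁ χ₂ t} = f1 '' {t | v ∈ χ₁ t} ∪ f2 '' {t | v ∈ χ₂ t} := by
      ext (t | t) <;> simp [f1, f2]
    have c1 := preconnected_induce_image f1 (h1 v)
    have c2 := preconnected_induce_image f2 (h2 v)
    rw [hset]
    by_cases e1 : ∃ t, v ∈ χ₁ t
    · by_cases e2 : ∃ t, v ∈ χ₂ t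
      · obtain ⟨⟨t, ht⟩, t', ht'⟩ := And.intro e1 e2
        obtain ⟨h3, h4⟩ := hr v t t' ht ht'
        exact SimpleGraph.connected_induce_union c1 c2 ⟨r, h3, rfl⟩ ⟨r, h4, rfl⟩
          (doubleGraph_adj_inl_inr.2 ⟨rfl, rfl⟩)
      · have : {t | v ∈ χ₂ t} = ∅ := eq_empty_iff_forall_notMem.2 fun t ht => e2 ⟨t, ht⟩
        rw [this, image_empty, union_empty]
        obtain ⟨t, ht⟩ := e1
        have : Nonempty (f1 '' {t | v ∈ χ₁ t}) := ⟨⟨_, t, ht, rfl⟩⟩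
        exact ⟨c1⟩
    · have : {t | v ∈ χ₁ t} = ∅ := eq_empty_iff_forall_notMem.2 fun t ht => e1 ⟨t, ht⟩
      rw [this, image_empty, empty_union]
      obtain ⟨t, ht⟩ := (hv v).resolve_left e1
      have : Nonempty (f2 '' {t | v ∈ χ₂ t}) := ⟨⟨_, t, ht, rfl⟩⟩
      exact ⟨c2⟩

theorem not_fatLexLE {f g : ℕ → ℕ} {j : ℕ} (hj : g j < f j) (h : ∀ i, j < i → f i = g i) :
    ¬ FatLexLE f g := by
  rintro (h' | ⟨i, hi, h'⟩)
  · exact hj.ne' (h' j)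
  · rcases lt_trichotomy i j with hij | rfl | hij
    · exact hj.ne' (h' j hij)
    · exact absurd hi hj.not_gt
    · exact hi.ne (h i hij)

theorem fatness_sum {V ι : Type} [Finite ι] (χ₁ χ₂ : ι → Set V) (i : ℕ) :
    fatness (Sum.elim χ₁ χ₂) i =
      {t | (χ₁ t).ncard = i}.ncard + {t | (χ₂ t).ncard = i}.ncard := by
  have : {t | (Sum.elim χ₁ χ₂ t).ncard = i} =
      Sum.inl '' {t | (χ₁ t).ncard = i} ∪ Sum.inr '' {t | (χ₂ t).ncard = i} := by
    ext (t | t) <;> simp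
  rw [fatness, this, ncard_union_eq ?_ (toFinite _) (toFinite _),
    ncard_image_of_injective _ Sum.inl_injective, ncard_image_of_injective _ Sum.inr_injective]
  rw [disjoint_left]
  rintro _ ⟨t, -, rfl⟩ ⟨t', -, h⟩
  exact Sum.inr_ne_inl h

/-- An atomic tree decomposition cannot be improved by splitting each bag in two. -/
theorem IsAtomicTD.false_of_double {V ι : Type} {m : ℕ} {G : SimpleGraph V}
    {T : SimpleGraph ι} {χ : ι → Set V} (hat : IsAtomicTD m G T χ) {r : ι} {χ₁ χ₂ : ι → Set V}
    (htd : IsTD G (doubleGraph T r) (Sum.elim χ₁ χ₂)) (ha1 : AdhLT T χ₁ m) (ha2 : AdhLT T χ₂ m)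
    (har : (χ₁ r ∩ χ₂ r).ncard < m) {s₀ : ι}
    (h₀ : (χ₁ s₀).ncard < (χ s₀).ncard ∧ (χ₂ s₀).ncard < (χ s₀).ncard)
    (h : ∀ s, ((χ₁ s).ncard < (χ s).ncard ∧ (χ₂ s).ncard < (χ s).ncard) ∨
      (χ₁ s = χ s ∧ (χ₂ s).ncard < (χ s₀).ncard) ∨
      (χ₂ s = χ s ∧ (χ₁ s).ncard < (χ s₀).ncard)) : False := by
  have := hat.1.finite
  obtain ⟨s₁, hs₁, hmax⟩ := exists_max_image
    {s | (χ₁ s).ncard < (χ s).ncard ∧ (χ₂ s).ncard < (χ s).ncard} (fun s => (χ s).ncard)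
    (toFinite _) ⟨s₀, h₀⟩
  have h01 : (χ s₀).ncard ≤ (χ s₁).ncard := hmax s₀ h₀
  have hdisj : ∀ i, (χ s₁).ncard ≤ i →
      Disjoint {t | (χ₁ t).ncard = i} {t | (χ₂ t).ncard = i} := by
    intro i hi
    rw [disjoint_left]
    intro t ht1 ht2
    simp only [mem_ofPred_eq] at ht1 ht2
    rcases h t with h | h | h
    · have := hmax t h
      omega
    · omega
    · omega
  have hsub : ∀ i, (χ s₁).ncard ≤ i →
      {t | (χ₁ t).ncard = i} ∪ {t | (χ₂ t).ncard = i} ⊆ {t | (χ t).ncard = i} := by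
    rintro i hi t (ht | ht) <;> simp only [mem_ofPred_eq] at ht ⊢ <;> rcases h t with h | h | h
    · have := hmax t h
      omega
    · rw [← h.1, ht]
    · omega
    · have := hmax t h
      omega
    · omega
    · rw [← h.1, ht]
  have hsum : ∀ i, (χ s₁).ncard ≤ i → fatness (Sum.elim χ₁ χ₂) i =
      ({t | (χ₁ t).ncard = i} ∪ {t | (χ₂ t).ncard = i}).ncard := fun i hi => by
    rw [fatness_sum, ncard_union_eq (hdisj i hi) (toFinite _) (toFinite _)]
  refine not_fatLexLE (j := (χ s₁).ncard) ?_ ?_ (hat.2.2 _ _ _ htd ?_)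
  · rw [hsum _ le_rfl]
    refine ncard_lt_ncard ⟨hsub _ le_rfl, fun hcon => ?_⟩ (toFinite _)
    have h1 : s₁ ∈ {t | (χ t).ncard = (χ s₁).ncard} := rfl
    rcases hcon h1 with h2 | h2
    · exact hs₁.1.ne h2
    · exact hs₁.2.ne h2
  · intro i hi
    rw [hsum i hi.le, fatness]
    congr 1
    refine subset_antisymm ?_ (hsub i hi.le)
    intro t ht
    simp only [mem_ofPred_eq] at ht
    rcases h t with h | h | h
    · have := hmax t h
      omega
    · left; simp only [mem_ofPred_eq]; rw [h.1, ht]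
    · right; simp only [mem_ofPred_eq]; rw [h.1, ht]
  · rintro (s | s) (s' | s') hs
    · exact ha1 (doubleGraph_adj_inl.1 hs)
    · obtain ⟨rfl, rfl⟩ := doubleGraph_adj_inl_inr.1 hs
      exact har
    · obtain ⟨rfl, rfl⟩ := doubleGraph_adj_inl_inr.1 hs.symm
      simp only [Sum.elim_inl, Sum.elim_inr]
      rw [inter_comm]
      exact har
    · exact ha2 (doubleGraph_adj_inr.1 hs)

theorem mem_branchSet_self {ι : Type} {T : SimpleGraph ι} {r s : ι} : s ∈ branchSet T r s :=
  fun w => w.start_mem_support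

theorem branchSet_root {ι : Type} {T : SimpleGraph ι} {r : ι} : branchSet T r r = univ :=
  eq_univ_of_forall fun _ w => w.end_mem_support

theorem eq_of_root_mem_branchSet {ι : Type} {T : SimpleGraph ι} {r s : ι}
    (h : r ∈ branchSet T r s) : s = r := by
  simpa using h .nil

theorem branchSet_trans {ι : Type} {T : SimpleGraph ι} {r s s' : ι} (h : s' ∈ branchSet T r s) :
    branchSet T r s' ⊆ branchSet T r s := by
  classical
  intro x hx w
  exact w.support_dropUntil_subset_support (hx w) (h (w.dropUntil s' (hx w)))

theorem eq_of_adj_branchSet {ι : Type} {T : SimpleGraph ι} {r s p q : ι}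
    (hp : p ∉ branchSet T r s) (hq : q ∈ branchSet T r s) (h : T.Adj p q) : q = s := by
  simp only [branchSet, mem_ofPred_eq, not_forall] at hp
  obtain ⟨w, hw⟩ := hp
  have := hq (.cons h.symm w)
  rw [SimpleGraph.Walk.support_cons, List.mem_cons] at this
  exact (this.resolve_right hw).symm

theorem parent_unique {ι : Type} {T : SimpleGraph ι} (hT : T.IsTree) {r s p p' : ι}
    (hp : p ∉ branchSet T r s) (hp' : p' ∉ branchSet T r s) (h : T.Adj s p) (h' : T.Adj s p') :
    p = p' := by
  classical
  by_contra hne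
  simp only [branchSet, mem_ofPred_eq, not_forall] at hp hp'
  obtain ⟨w, hw⟩ := hp
  obtain ⟨w', hw'⟩ := hp'
  have hq : s ∉ (w.append w'.reverse).support := by
    simp [SimpleGraph.Walk.mem_support_append_iff, hw, hw']
  let q : T.Walk p p' := .cons h.symm (.cons h' .nil)
  have hqp : q.IsPath := by
    simp [q, SimpleGraph.Walk.cons_isPath_iff, h'.ne, h.ne', hne]
  have := (hT.isAcyclic.subsingleton_path p p').elim ⟨q, hqp⟩ (w.append w'.reverse).toPath
  have h2 : s ∈ ((w.append w'.reverse).toPath : T.Walk p p').support := by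
    rw [← this]
    simp [q]
  exact hq ((w.append w'.reverse).support_bypass_subset_support h2)

theorem mem_branchSet_or {ι : Type} {T : SimpleGraph ι} (hT : T.IsTree) {r s s' : ι}
    (h : T.Adj s s') : s' ∈ branchSet T r s ∨ s ∈ branchSet T r s' := by
  by_contra! hcon
  simp only [branchSet, mem_ofPred_eq, not_forall] at hcon
  obtain ⟨⟨w', hw'⟩, w, hw⟩ := hcon
  have := SimpleGraph.isAcyclic_iff_forall_adj_isBridge.1 hT.isAcyclic h
  have := (SimpleGraph.isBridge_iff_forall_walk_mem_edges.1 this) (w.append w'.reverse)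
  rw [SimpleGraph.Walk.edges_append, List.mem_append, SimpleGraph.Walk.edges_reverse,
    List.mem_reverse] at this
  rcases this with h | h
  · exact hw (w.snd_mem_support_of_mem_edges h)
  · exact hw' (w'.fst_mem_support_of_mem_edges h)

theorem dist_lt_of_mem_branchSet {ι : Type} {T : SimpleGraph ι} (hT : T.IsTree) {r s s' : ι}
    (h : s' ∈ branchSet T r s) (hne : s' ≠ s) : T.dist s r < T.dist s' r := by
  classical
  obtain ⟨w, hw⟩ := hT.connected.exists_walk_length_eq_dist s' r
  have h1 := SimpleGraph.dist_le (w.dropUntil s (h w))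
  have h2 := congrArg SimpleGraph.Walk.length (w.take_spec (h w))
  rw [SimpleGraph.Walk.length_append] at h2
  have h3 : (w.takeUntil s (h w)).length ≠ 0 := fun h0 =>
    hne (SimpleGraph.Walk.eq_of_length_eq_zero h0)
  omega

theorem notMem_branchSet_of_mem {ι : Type} {T : SimpleGraph ι} (hT : T.IsTree) {r s s' : ι}
    (hne : s' ≠ s) (h : s' ∈ branchSet T r s) : s ∉ branchSet T r s' := fun h' => by
  have h1 := dist_lt_of_mem_branchSet hT h hne
  have h2 := dist_lt_of_mem_branchSet hT h' hne.symm
  omega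

theorem notMem_branchSet_of_adj_root {ι : Type} {T : SimpleGraph ι} {r y : ι} (h : T.Adj r y) :
    r ∉ branchSet T r y := fun hr => h.ne' (eq_of_root_mem_branchSet hr)

theorem mem_sideSet {V ι : Type} {T : SimpleGraph ι} {χ : ι → Set V} {r s : ι} {x : V} :
    x ∈ sideSet T χ r s ↔ ∃ s' ∈ branchSet T r s, x ∈ χ s' := by
  simp [sideSet]

theorem bag_subset_sideSet {V ι : Type} {T : SimpleGraph ι} {χ : ι → Set V} {r s : ι} :
    χ s ⊆ sideSet T χ r s := fun _ hx => mem_sideSet.2 ⟨s, mem_branchSet_self, hx⟩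

theorem sideSet_mono {V ι : Type} {T : SimpleGraph ι} {χ : ι → Set V} {r s s' : ι}
    (h : s' ∈ branchSet T r s) : sideSet T χ r s' ⊆ sideSet T χ r s :=
  biUnion_subset_biUnion_left (branchSet_trans h)

namespace IsTD

variable {V ι : Type} {G : SimpleGraph V} {T : SimpleGraph ι} {χ : ι → Set V} {r s s' p q : ι}
  {x b : V}

theorem exists_parent (h : IsTD G T χ) (hp : p ∉ branchSet T r s) (hxp : x ∈ χ p)
    (hx : x ∈ sideSet T χ r s) : x ∈ χ s ∧ ∃ p', T.Adj s p' ∧ p' ∉ branchSet T r s ∧ x ∈ χ p' := by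
  obtain ⟨q, hq, hxq⟩ := mem_sideSet.1 hx
  obtain ⟨a, ha, c, hc, hab, hcb, hac⟩ := exists_adj_leaving (h.subtree x).preconnected
    (F := (branchSet T r s)ᶜ) hxp hxq hp (fun hn => hn hq)
  obtain rfl := eq_of_adj_branchSet hab (not_not.1 hcb) hac
  exact ⟨hc, a, hac.symm, hab, ha⟩

theorem mem_bag (h : IsTD G T χ) (hp : p ∉ branchSet T r s) (hxp : x ∈ χ p)
    (hx : x ∈ sideSet T χ r s) : x ∈ χ s :=
  (h.exists_parent hp hxp hx).1

theorem mem_inter (h : IsTD G T χ) (hs : T.Adj s s') (hss : s ∉ branchSet T r s')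
    (hp : p ∉ branchSet T r s') (hxp : x ∈ χ p) (hx : x ∈ sideSet T χ r s') :
    x ∈ χ s ∩ χ s' := by
  obtain ⟨h1, p', h2, h3, h4⟩ := h.exists_parent hp hxp hx
  obtain rfl := parent_unique h.isTree h3 hss h2 hs.symm
  exact ⟨h4, h1⟩

theorem mem_sideSet_of_adj (h : IsTD G T χ) (hx : x ∈ sideSet T χ r s) (hxs : x ∉ χ s)
    (hb : G.Adj x b) : b ∈ sideSet T χ r s := by
  obtain ⟨q, hxq, hbq⟩ := h.edgeBag hb
  by_cases hq : q ∈ branchSet T r s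
  · exact mem_sideSet.2 ⟨q, hq, hbq⟩
  · exact absurd (h.mem_bag hq hxq hx) hxs

theorem mem_sideSet_of_adj_of_child (h : IsTD G T χ) (hs : T.Adj s s')
    (hss : s ∉ branchSet T r s') (hx : x ∈ sideSet T χ r s') (hxs : x ∉ χ s ∩ χ s')
    (hb : G.Adj x b) : b ∈ sideSet T χ r s' := by
  obtain ⟨q, hxq, hbq⟩ := h.edgeBag hb
  by_cases hq : q ∈ branchSet T r s'
  · exact mem_sideSet.2 ⟨q, hq, hbq⟩
  · exact absurd (h.mem_inter hs hss hq hxq hx) hxs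

theorem mem_bag_of_root (h : IsTD G T χ) (hxr : x ∈ χ r) (hx : x ∈ sideSet T χ r s) :
    x ∈ χ s := by
  by_cases hr : r ∈ branchSet T r s
  · rwa [eq_of_root_mem_branchSet hr]
  · exact h.mem_bag hr hxr hx

theorem mem_inter_of_root (h : IsTD G T χ) (hs : T.Adj s s') (hss : s' ∈ branchSet T r s)
    (hxr : x ∈ χ r) (hx : x ∈ sideSet T χ r s') : x ∈ χ s ∩ χ s' := by
  have hss' := notMem_branchSet_of_mem h.isTree hs.ne' hss
  refine h.mem_inter hs hss' (fun hr => ?_) hxr hx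
  rw [eq_of_root_mem_branchSet hr, branchSet_root] at hss'
  exact hss' (mem_univ _)

end IsTD

theorem preconnected_induce_inter {ι : Type} {T : SimpleGraph ι} (hT : T.IsAcyclic) {A B : Set ι}
    (hA : (T.induce A).Preconnected) (hB : (T.induce B).Preconnected) :
    (T.induce (A ∩ B)).Preconnected := by
  classical
  have key : ∀ C : Set ι, (T.induce C).Preconnected → ∀ p ∈ C, ∀ q ∈ C,
      ∃ P : T.Path p q, ∀ x ∈ (P : T.Walk p q).support, x ∈ C := by
    intro C hC p hp q hq
    obtain ⟨w⟩ := hC ⟨p, hp⟩ ⟨q, hq⟩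
    let f : T.induce C →g T := (SimpleGraph.Embedding.induce C).toHom
    refine ⟨(w.map f).toPath, fun x hx => ?_⟩
    have := (w.map f).support_bypass_subset_support hx
    rw [SimpleGraph.Walk.support_map, List.mem_map] at this
    obtain ⟨z, -, rfl⟩ := this
    exact z.2
  rintro ⟨p, hp⟩ ⟨q, hq⟩
  obtain ⟨P, hP⟩ := key A hA p hp.1 q hq.1
  obtain ⟨Q, hQ⟩ := key B hB p hp.2 q hq.2
  obtain rfl := (hT.subsingleton_path p q).elim P Q
  exact ⟨(P : T.Walk p q).induce (A ∩ B) fun x hx => ⟨hP x hx, hQ x hx⟩⟩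

theorem preconnected_induce_compl_branchSet {ι : Type} {T : SimpleGraph ι} {r s : ι} :
    (T.induce (branchSet T r s)ᶜ).Preconnected := by
  classical
  by_cases hr : r ∈ branchSet T r s
  · rw [eq_of_root_mem_branchSet hr, branchSet_root, compl_univ]
    exact fun a => a.2.elim
  have key : ∀ p : ↥(branchSet T r s)ᶜ, (T.induce (branchSet T r s)ᶜ).Reachable p ⟨r, hr⟩ := by
    rintro ⟨p, hp⟩
    have hp' := hp
    simp only [branchSet, mem_compl_iff, mem_ofPred_eq, not_forall] at hp'
    obtain ⟨w, hw⟩ := hp'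
    exact ⟨w.induce (branchSet T r s)ᶜ fun x hx hxs =>
      hw (w.support_dropUntil_subset_support hx (hxs (w.dropUntil x hx)))⟩
  exact fun p q => (key p).trans (key q).symm

open Classical in
/-- In an atomic tree decomposition, a separation that splits the adhesion set of an edge `ry` meets
the part of the graph strictly beyond that edge. -/
theorem IsAtomicTD.exists_mem_inter_branch {V ι : Type} [Finite V] {m : ℕ} {G : SimpleGraph V}
    {T : SimpleGraph ι} {χ : ι → Set V} (hat : IsAtomicTD m G T χ) {r y : ι} (hy : T.Adj r y)
    {A B : Set V} (hAB : IsSeparation G A B) {v w : V} (hv : v ∈ χ r ∩ χ y) (hw : w ∈ χ r ∩ χ y)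
    (hvA : v ∉ A) (hwB : w ∉ B) : ∃ x ∈ A ∩ B, x ∈ sideSet T χ r y ∧ x ∉ χ r := by
  by_contra! hno
  have hvB := (hAB.mem_or v).resolve_left hvA
  have hwA := (hAB.mem_or w).resolve_right hwB
  have htd := hat.1
  have hfin := htd.finite
  have hrβ := notMem_branchSet_of_adj_root hy
  have hyβ : y ∈ branchSet T r y := mem_branchSet_self
  set W := χ r ∩ χ y with hW
  have hcross : ∀ {x p q}, p ∉ branchSet T r y → x ∈ χ p → q ∈ branchSet T r y → x ∈ χ q →
      x ∈ W := fun hp hxp hq hxq =>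
    htd.mem_inter hy hrβ hp hxp (mem_sideSet.2 ⟨_, hq, hxq⟩)
  let χ₁ : ι → Set V := fun s => if s ∈ branchSet T r y then χ s ∩ A else χ s
  let χ₂ : ι → Set V := fun s => if s ∈ branchSet T r y then χ s ∩ B else χ s ∩ (W ∩ B)
  have h1le : ∀ s, χ₁ s ⊆ χ s := fun s => by
    simp only [χ₁]; split_ifs <;> simp
  have h2le : ∀ s, χ₂ s ⊆ χ s := fun s => by
    simp only [χ₂]; split_ifs <;> simp
  have hadh : ∀ χ' : ι → Set V, (∀ s, χ' s ⊆ χ s) → AdhLT T χ' m := fun χ' hle s s' hs =>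
    (ncard_le_ncard (inter_subset_inter (hle s) (hle s')) (toFinite _)).trans_lt (hat.2.1 hs)
  have hWA : (W ∩ A).ncard < (χ y).ncard := ncard_lt_ncard
    ⟨fun x hx => hx.1.2, fun h => hvA (h hv.2).2⟩ (toFinite _)
  have hWB : (W ∩ B).ncard < (χ y).ncard := ncard_lt_ncard
    ⟨fun x hx => hx.1.2, fun h => hwB (h hw.2).2⟩ (toFinite _)
  refine hat.false_of_double (r := r) (χ₁ := χ₁) (χ₂ := χ₂) (s₀ := y) ?_
    (hadh _ h1le) (hadh _ h2le) ?_ ⟨?_, ?_⟩ ?_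
  · refine isTD_double htd.isTree r ?_ ?_ ?_ ?_ ?_
    · intro x
      obtain ⟨s, hs⟩ := htd.memBag x
      by_cases hsβ : s ∈ branchSet T r y
      · rcases hAB.mem_or x with h | h
        · exact .inl ⟨s, by simp only [χ₁, if_pos hsβ]; exact ⟨hs, h⟩⟩
        · exact .inr ⟨s, by simp only [χ₂, if_pos hsβ]; exact ⟨hs, h⟩⟩
      · exact .inl ⟨s, by simp only [χ₁, if_neg hsβ]; exact hs⟩
    · intro a b hab
      obtain ⟨s, has, hbs⟩ := htd.edgeBag hab
      by_cases hsβ : s ∈ branchSet T r y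
      · rcases hAB.adj_mem_or hab with ⟨h1, h2⟩ | ⟨h1, h2⟩
        · exact .inl ⟨s, by simp only [χ₁, if_pos hsβ]; exact ⟨⟨has, h1⟩, hbs, h2⟩⟩
        · exact .inr ⟨s, by simp only [χ₂, if_pos hsβ]; exact ⟨⟨has, h1⟩, hbs, h2⟩⟩
      · exact .inl ⟨s, by simp only [χ₁, if_neg hsβ]; exact ⟨has, hbs⟩⟩
    · intro x
      by_cases hx : x ∈ A
      · have : {s | x ∈ χ₁ s} = {s | x ∈ χ s} := by
          ext s; simp only [χ₁, mem_ofPred_eq]; split_ifs <;> simp [hx]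
        rw [this]
        exact (htd.subtree x).preconnected
      · have : {s | x ∈ χ₁ s} = {s | x ∈ χ s} ∩ (branchSet T r y)ᶜ := by
          ext s
          simp only [χ₁, mem_ofPred_eq, mem_inter_iff, mem_compl_iff]
          split_ifs with h <;> simp [hx, h]
        rw [this]
        exact preconnected_induce_inter htd.isTree.isAcyclic (htd.subtree x).preconnected
          preconnected_induce_compl_branchSet
    · intro x
      by_cases hx : x ∈ B ∧ (x ∈ W ∨ x ∈ sideSet T χ r y)
      · have : {s | x ∈ χ₂ s} = {s | x ∈ χ s} := by
          ext s
          simp only [χ₂, mem_ofPred_eq]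
          split_ifs with h
          · simp [hx.1]
          · refine ⟨And.left, fun hs => ⟨hs, ?_, hx.1⟩⟩
            exact hx.2.elim id (htd.mem_inter hy hrβ h hs)
        rw [this]
        exact (htd.subtree x).preconnected
      · have : {s | x ∈ χ₂ s} = ∅ := by
          refine eq_empty_iff_forall_notMem.2 fun s hs => hx ?_
          simp only [χ₂, mem_ofPred_eq] at hs
          split_ifs at hs with h
          · exact ⟨hs.2, .inr (mem_sideSet.2 ⟨s, h, hs.1⟩)⟩
          · exact ⟨hs.2.2, .inl hs.2.1⟩
        rw [this]
        exact fun a => a.2.elim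
    · intro x s s' hs hs'
      have : x ∈ W ∧ x ∈ B := by
        simp only [χ₁, χ₂] at hs hs'
        split_ifs at hs hs' with h h' h'
        · exact ⟨hcross hrβ (hno x ⟨hs.2, hs'.2⟩ (mem_sideSet.2 ⟨s, h, hs.1⟩)) h hs.1, hs'.2⟩
        · exact hs'.2
        · exact ⟨hcross h hs h' hs'.1, hs'.2⟩
        · exact hs'.2
      simp only [χ₁, χ₂, if_neg hrβ]
      exact ⟨this.1.1, this.1.1, this⟩
  · refine (ncard_le_ncard ?_ (toFinite _)).trans_lt (hat.2.1 hy)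
    simp only [χ₁, χ₂, if_neg hrβ]
    exact fun x hx => hx.2.2.1
  · simp only [χ₁, if_pos hyβ]
    exact ncard_lt_ncard ⟨inter_subset_left, fun h => hvA (h hv.2).2⟩ (toFinite _)
  · simp only [χ₂, if_pos hyβ]
    exact ncard_lt_ncard ⟨inter_subset_left, fun h => hwB (h hw.2).2⟩ (toFinite _)
  · intro s
    have hside : s ∈ branchSet T r y → χ s ∩ (A ∩ B) ⊆ W := fun h x hx =>
      hcross hrβ (hno x hx.2 (mem_sideSet.2 ⟨s, h, hx.1⟩)) h hx.1
    by_cases h : s ∈ branchSet T r y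
    · simp only [χ₁, χ₂, if_pos h]
      by_cases hA : χ s ⊆ A
      · refine .inr (.inl ⟨inter_eq_left.2 hA, (ncard_le_ncard ?_ (toFinite _)).trans_lt hWB⟩)
        exact fun x hx => ⟨hside h ⟨hx.1, hA hx.1, hx.2⟩, hx.2⟩
      by_cases hB : χ s ⊆ B
      · refine .inr (.inr ⟨inter_eq_left.2 hB, (ncard_le_ncard ?_ (toFinite _)).trans_lt hWA⟩)
        exact fun x hx => ⟨hside h ⟨hx.1, hx.2, hB hx.1⟩, hx.2⟩
      · exact .inl ⟨ncard_lt_ncard ⟨inter_subset_left, fun h' => hA fun x hx => (h' hx).2⟩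
          (toFinite _), ncard_lt_ncard ⟨inter_subset_left, fun h' => hB fun x hx => (h' hx).2⟩
          (toFinite _)⟩
    · simp only [χ₁, χ₂, if_neg h]
      exact .inr (.inl ⟨trivial, (ncard_le_ncard inter_subset_right (toFinite _)).trans_lt hWB⟩)

theorem mem_branchSet_of_mem_path {ι : Type} {T : SimpleGraph ι} (hT : T.IsTree) {r s z : ι}
    (P : T.Path s r) (hz : z ∈ (P : T.Walk s r).support) : s ∈ branchSet T r z := by
  classical
  intro w
  have h := (hT.isAcyclic.subsingleton_path s r).elim w.toPath P
  exact w.support_bypass_subset_support (by rw [← h] at hz; exact hz)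

theorem preconnected_induce_sideSet {V ι : Type} {T : SimpleGraph ι} (hT : T.IsTree)
    {χ : ι → Set V} {r : ι} {x : V} :
    (T.induce {s | x ∈ sideSet T χ r s}).Preconnected := by
  have key : ∀ s, ∀ hs : x ∈ sideSet T χ r s, ∀ hr : x ∈ sideSet T χ r r,
      (T.induce {s | x ∈ sideSet T χ r s}).Reachable ⟨s, hs⟩ ⟨r, hr⟩ := by
    intro s hs hr
    classical
    obtain ⟨w⟩ := hT.connected s r
    exact ⟨(w.toPath : T.Walk s r).induce {s | x ∈ sideSet T χ r s} fun z hz =>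
      sideSet_mono (mem_branchSet_of_mem_path hT w.toPath hz) hs⟩
  rintro ⟨s, hs⟩ ⟨s', hs'⟩
  have hr : x ∈ sideSet T χ r r := sideSet_mono (by rw [branchSet_root]; trivial) hs
  exact (key s hs hr).trans (key s' hs' hr).symm

theorem IsSeparation.exchange {V : Type} {G : SimpleGraph V} {A B F S : Set V}
    (hAB : IsSeparation G A B) (hFS : ∀ a ∈ F, ∀ b, G.Adj a b → b ∈ F ∪ S) :
    IsSeparation G (A ∪ (B ∩ (F ∪ S))) (B \ F) := by
  refine ⟨eq_univ_of_forall fun x => ?_, fun a b ha ha' hb hb' hab => ?_⟩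
  · have := hAB.mem_or x
    simp only [mem_union, mem_inter_iff, mem_sdiff]
    tauto
  · have h1 := hAB.2 a b
    have h2 := hFS a
    simp only [mem_union, mem_inter_iff, mem_sdiff] at ha ha' hb hb' h2
    by_cases haF : a ∈ F
    · have := h2 haF b hab
      tauto
    · tauto

/-- The total weight of `X`. -/
noncomputable def weightSum {V : Type} [Fintype V] (f : V → ℕ) (X : Set V) : ℕ :=
  ∑ x, X.indicator f x

theorem weightSum_union {V : Type} [Fintype V] (f : V → ℕ) {X Y : Set V} (h : Disjoint X Y) :
    weightSum f (X ∪ Y) = weightSum f X + weightSum f Y := by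
  simp only [weightSum, ← Finset.sum_add_distrib]
  refine Finset.sum_congr rfl fun x _ => ?_
  rw [indicator_union_of_disjoint h]

theorem weightSum_const {V : Type} [Fintype V] (c : ℕ) (X : Set V) :
    weightSum (fun _ => c) X = c * X.ncard := by
  classical
  simp only [weightSum, indicator_apply]
  rw [← Finset.sum_filter, Finset.sum_const, smul_eq_mul, mul_comm, ← ncard_coe_finset]
  simp

theorem weightSum_mono {V : Type} [Fintype V] {f g : V → ℕ} {X : Set V}
    (h : ∀ x ∈ X, f x ≤ g x) : weightSum f X ≤ weightSum g X :=
  Finset.sum_le_sum fun x _ => indicator_le_indicator' (h x)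

theorem weightSum_le_sum {V : Type} [Fintype V] (f : V → ℕ) (X : Set V) :
    weightSum f X ≤ ∑ x, f x :=
  Finset.sum_le_sum fun x _ => indicator_le_self X f x

/-- The weight of a vertex set, comparing first by size and then by total depth. -/
noncomputable def cost {V : Type} [Fintype V] (d : V → ℕ) (X : Set V) : ℕ :=
  (1 + ∑ x, d x) * X.ncard + weightSum d X

theorem cost_union {V : Type} [Fintype V] (d : V → ℕ) {X Y : Set V} (h : Disjoint X Y) :
    cost d (X ∪ Y) = cost d X + cost d Y := by
  rw [cost, cost, cost, weightSum_union d h, ncard_union_eq h (toFinite _) (toFinite _)]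
  ring

theorem ncard_le_of_cost_le {V : Type} [Fintype V] {d : V → ℕ} {X Y : Set V}
    (h : cost d X ≤ cost d Y) : X.ncard ≤ Y.ncard := by
  have h1 := weightSum_le_sum d Y
  by_contra! hlt
  have h2 := Nat.mul_le_mul_left (1 + ∑ x, d x) (Nat.succ_le_of_lt hlt)
  rw [cost, cost] at h
  rw [Nat.mul_succ] at h2
  omega

theorem ncard_lt_of_cost_le {V : Type} [Fintype V] {d : V → ℕ} {X Y : Set V} {K : ℕ}
    (h : cost d X ≤ cost d Y) (hX : ∀ x ∈ X, K < d x) (hY : ∀ x ∈ Y, d x ≤ K)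
    (hne : Y.Nonempty) : X.ncard < Y.ncard := by
  refine lt_of_le_of_ne (ncard_le_of_cost_le h) fun heq => ?_
  have h1 : (K + 1) * X.ncard ≤ weightSum d X := by
    rw [← weightSum_const]; exact weightSum_mono hX
  have h2 : weightSum d Y ≤ K * Y.ncard := by
    rw [← weightSum_const]; exact weightSum_mono hY
  have h3 := (ncard_pos (toFinite _)).2 hne
  rw [cost, cost, heq] at h
  rw [heq, Nat.succ_mul] at h1
  omega

/-- Pushing a cheapest separation past a barrier `S` does not make it cheaper. -/
theorem IsSeparation.barrier {V : Type} [Fintype V] {G : SimpleGraph V} {A B F S R : Set V}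
    {d : V → ℕ} {m K : ℕ} (hAB : IsSeparation G A B)
    (hA : m ≤ (A ∩ R).ncard) (hB : m ≤ (B ∩ R).ncard)
    (hmin : ∀ A' B', IsSeparation G A' B' → m ≤ (A' ∩ R).ncard → m ≤ (B' ∩ R).ncard →
      cost d (A ∩ B) ≤ cost d (A' ∩ B'))
    (hdisj : Disjoint F S) (hFS : ∀ a ∈ F, ∀ b, G.Adj a b → b ∈ F ∪ S) (hFR : Disjoint F R)
    (hF : ∀ x ∈ F, K < d x) (hS : ∀ x ∈ S, d x ≤ K) :
    (A ∩ B ∩ F).ncard < (S \ A).ncard ∨ (S ⊆ A ∧ A ∩ B ∩ F = ∅) := by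
  have h1 := hmin _ _ (hAB.exchange hFS)
    (hA.trans (ncard_le_ncard (inter_subset_inter_left _ subset_union_left) (toFinite _)))
    (hB.trans (ncard_le_ncard
      (fun x hx => ⟨⟨hx.1, fun hxF => disjoint_left.1 hFR hxF hx.2⟩, hx.2⟩) (toFinite _)))
  have h2 : (A ∪ (B ∩ (F ∪ S))) ∩ (B \ F) = (A ∩ B) \ F ∪ S \ A := by
    ext x
    have := hAB.mem_or x
    have : x ∈ F → x ∉ S := fun h => disjoint_left.1 hdisj h
    simp only [mem_union, mem_inter_iff, mem_sdiff]
    tauto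
  have h3 : Disjoint ((A ∩ B) \ F) (S \ A) := disjoint_left.2 fun x hx hx' => hx'.2 hx.1.1
  have h4 : cost d (A ∩ B) = cost d ((A ∩ B) \ F) + cost d (A ∩ B ∩ F) := by
    rw [← cost_union d (disjoint_left.2 fun x hx hx' => hx.2 hx'.2), sdiff_union_inter]
  rw [h2, cost_union d h3, h4] at h1
  have h5 : cost d (A ∩ B ∩ F) ≤ cost d (S \ A) := by omega
  by_cases hne : (S \ A).Nonempty
  · exact .inl (ncard_lt_of_cost_le h5 (fun x hx => hF x hx.2) (fun x hx => hS x hx.1) hne)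
  · rw [not_nonempty_iff_eq_empty] at hne
    refine .inr ⟨sdiff_eq_empty.1 hne, ?_⟩
    have h6 := ncard_le_of_cost_le h5
    rw [hne, ncard_empty, Nat.le_zero, ncard_eq_zero (toFinite _)] at h6
    exact h6

theorem ncard_inter_union_le {V : Type} [Finite V] {S A Y : Set V}
    (h : Y.ncard < (S \ A).ncard ∨ (S ⊆ A ∧ Y = ∅)) : (S ∩ A ∪ Y).ncard ≤ S.ncard ∧
      (¬ S ⊆ A → (S ∩ A ∪ Y).ncard < S.ncard) := by
  have h1 := ncard_union_le (S ∩ A) Y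
  have h2 := ncard_inter_add_ncard_sdiff_eq_ncard S A (toFinite _)
  rcases h with h | ⟨h, rfl⟩
  · exact ⟨by omega, fun _ => by omega⟩
  · rw [ncard_empty] at h1
    exact ⟨by omega, fun h' => absurd h h'⟩

/-- One side of the bags obtained by splitting along `A ∩ B = X`. -/
def splitBag {V ι : Type} (T : SimpleGraph ι) (χ : ι → Set V) (r : ι) (A X : Set V) (s : ι) :
    Set V :=
  χ s ∩ A ∪ X ∩ sideSet T χ r s

theorem IsTD.splitBag_spec {V ι : Type} [Fintype V] {G : SimpleGraph V} {T : SimpleGraph ι}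
    {χ : ι → Set V} {m : ℕ} (htd : IsTD G T χ) (hadh : AdhLT T χ m) {r : ι} {A B : Set V}
    {d : V → ℕ} (hd1 : ∀ x s, x ∈ χ s → d x ≤ T.dist s r)
    (hd2 : ∀ x, ∃ s, x ∈ χ s ∧ d x = T.dist s r)
    (hAB : IsSeparation G A B) (hA : m ≤ (A ∩ χ r).ncard) (hB : m ≤ (B ∩ χ r).ncard)
    (hmin : ∀ A' B', IsSeparation G A' B' → m ≤ (A' ∩ χ r).ncard → m ≤ (B' ∩ χ r).ncard →
      cost d (A ∩ B) ≤ cost d (A' ∩ B')) :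
    AdhLT T (splitBag T χ r A (A ∩ B)) m ∧ ∀ s,
      (χ s ⊆ A → splitBag T χ r A (A ∩ B) s = χ s) ∧
      (¬ χ s ⊆ A → (splitBag T χ r A (A ∩ B) s).ncard < (χ s).ncard) := by
  constructor
  · have key : ∀ s s', T.Adj s s' → s' ∈ branchSet T r s →
        (splitBag T χ r A (A ∩ B) s ∩ splitBag T χ r A (A ∩ B) s').ncard < m := by
      intro s s' hs hss
      have hss' := notMem_branchSet_of_mem htd.isTree hs.ne' hss
      have hbar := hAB.barrier (F := sideSet T χ r s' \ (χ s ∩ χ s')) (S := χ s ∩ χ s')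
        (K := T.dist s r) hA hB hmin disjoint_sdiff_left ?_ ?_ ?_ ?_
      · refine (ncard_le_ncard ?_ (toFinite _)).trans_lt
          ((ncard_inter_union_le hbar).1.trans_lt (hadh hs))
        rintro x ⟨hx, hx'⟩
        by_cases hxS : x ∈ χ s ∩ χ s'
        · rcases hx with hx | hx
          · exact .inl ⟨hxS, hx.2⟩
          · exact .inl ⟨hxS, hx.1.1⟩
        · right
          have hxs' : x ∈ sideSet T χ r s' := hx'.elim (fun h => bag_subset_sideSet h.1) And.right
          refine ⟨?_, hxs', hxS⟩
          rcases hx with hx | hx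
          · rcases hx' with hx' | hx'
            · exact absurd ⟨hx.1, hx'.1⟩ hxS
            · exact hx'.1
          · exact hx.1
      · intro a ha b hab
        rw [sdiff_union_self]
        exact .inl (htd.mem_sideSet_of_adj_of_child hs hss' ha.1 ha.2 hab)
      · exact disjoint_left.2 fun x hx hxr => hx.2 (htd.mem_inter_of_root hs hss hxr hx.1)
      · intro x hx
        obtain ⟨q, hxq, hq⟩ := hd2 x
        rw [hq]
        by_cases hqb : q ∈ branchSet T r s'
        · have h1 := dist_lt_of_mem_branchSet htd.isTree hss hs.ne'
          by_cases hqs : q = s'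
          · rw [hqs]; exact h1
          · exact h1.trans (dist_lt_of_mem_branchSet htd.isTree hqb hqs)
        · exact absurd (htd.mem_inter hs hss' hqb hxq hx.1) hx.2
      · exact fun x hx => hd1 x s hx.1
    intro s s' hs
    rcases mem_branchSet_or htd.isTree (r := r) hs with h | h
    · exact key s s' hs h
    · rw [inter_comm]
      exact key s' s hs.symm h
  · intro s
    have hbar := hAB.barrier (F := sideSet T χ r s \ χ s) (S := χ s)
      (K := T.dist s r) hA hB hmin disjoint_sdiff_left ?_ ?_ ?_ ?_
    · have heq : splitBag T χ r A (A ∩ B) s = χ s ∩ A ∪ A ∩ B ∩ (sideSet T χ r s \ χ s) := by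
        ext x
        simp only [splitBag, mem_union, mem_inter_iff, mem_sdiff]
        tauto
      rw [heq]
      refine ⟨fun h => ?_, (ncard_inter_union_le hbar).2⟩
      rcases hbar with hbar | hbar
      · rw [sdiff_eq_empty.2 h, ncard_empty] at hbar
        omega
      · rw [hbar.2, union_empty, inter_eq_left.2 h]
    · intro a ha b hab
      rw [sdiff_union_self]
      exact .inl (htd.mem_sideSet_of_adj ha.1 ha.2 hab)
    · exact disjoint_left.2 fun x hx hxr => hx.2 (htd.mem_bag_of_root hxr hx.1)
    · intro x hx
      obtain ⟨q, hxq, hq⟩ := hd2 x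
      rw [hq]
      by_cases hqb : q ∈ branchSet T r s
      · exact dist_lt_of_mem_branchSet htd.isTree hqb fun h => hx.2 (h ▸ hxq)
      · exact absurd (htd.mem_bag hqb hxq hx.1) hx.2
    · exact fun x hx => hd1 x s hx

theorem IsTD.preconnected_splitBag {V ι : Type} {G : SimpleGraph V} {T : SimpleGraph ι}
    {χ : ι → Set V} (htd : IsTD G T χ) {r : ι} {A X : Set V} (x : V) :
    (T.induce {s | x ∈ splitBag T χ r A X s}).Preconnected := by
  by_cases hxX : x ∈ X
  · have : {s | x ∈ splitBag T χ r A X s} = {s | x ∈ sideSet T χ r s} := by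
      ext s
      simp only [splitBag, mem_ofPred_eq, mem_union, mem_inter_iff, hxX, true_and]
      exact ⟨fun h => h.elim (fun h => bag_subset_sideSet h.1) id, .inr⟩
    rw [this]
    exact preconnected_induce_sideSet htd.isTree
  · by_cases hxA : x ∈ A
    · have : {s | x ∈ splitBag T χ r A X s} = {s | x ∈ χ s} := by
        ext s
        simp [splitBag, hxX, hxA]
      rw [this]
      exact (htd.subtree x).preconnected
    · have : {s | x ∈ splitBag T χ r A X s} = ∅ := by
        ext s
        simp [splitBag, hxX, hxA]
      rw [this]
      exact fun a => a.2.elim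

/-- In an atomic tree decomposition, no separation of order less than `m` has at least `m` vertices
of a bag on each side. -/
theorem IsAtomicTD.false_of_separation {V ι : Type} [Finite V] {m : ℕ} {G : SimpleGraph V}
    {T : SimpleGraph ι} {χ : ι → Set V} (hat : IsAtomicTD m G T χ) {r : ι} {A B : Set V}
    (hAB : IsSeparation G A B) (hm : (A ∩ B).ncard < m) (hA : m ≤ (A ∩ χ r).ncard)
    (hB : m ≤ (B ∩ χ r).ncard) : False := by
  have := Fintype.ofFinite V
  have htd := hat.1
  have hfin := htd.finite
  have hd : ∀ x, ∃ k, (∀ s, x ∈ χ s → k ≤ T.dist s r) ∧ ∃ s, x ∈ χ s ∧ k = T.dist s r := by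
    intro x
    obtain ⟨s, hs, hmin⟩ := exists_min_image {s | x ∈ χ s} (fun s => T.dist s r) (toFinite _)
      (htd.memBag x)
    exact ⟨_, hmin, s, hs, rfl⟩
  choose d hd1 hd2 using hd
  obtain ⟨⟨A', B'⟩, ⟨hAB', hA', hB'⟩, hmin⟩ := exists_min_image
    {p : Set V × Set V | IsSeparation G p.1 p.2 ∧ m ≤ (p.1 ∩ χ r).ncard ∧ m ≤ (p.2 ∩ χ r).ncard}
    (fun p => cost d (p.1 ∩ p.2)) (toFinite _) ⟨(A, B), hAB, hA, hB⟩
  have hm' : (A' ∩ B').ncard < m :=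
    (ncard_le_of_cost_le (hmin (A, B) ⟨hAB, hA, hB⟩)).trans_lt hm
  clear hAB hA hB hm
  change m ≤ (A' ∩ χ r).ncard at hA'
  change m ≤ (B' ∩ χ r).ncard at hB'
  have hmin1 : ∀ P Q, IsSeparation G P Q → m ≤ (P ∩ χ r).ncard → m ≤ (Q ∩ χ r).ncard →
      cost d (A' ∩ B') ≤ cost d (P ∩ Q) := fun P Q h h1 h2 => hmin (P, Q) ⟨h, h1, h2⟩
  obtain ⟨hadh1, hbag1⟩ := htd.splitBag_spec hat.2.1 hd1 hd2 hAB' hA' hB' hmin1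
  obtain ⟨hadh2, hbag2⟩ := htd.splitBag_spec hat.2.1 hd1 hd2 hAB'.symm hB' hA'
    fun P Q h h1 h2 => by rw [inter_comm]; exact hmin1 P Q h h1 h2
  rw [inter_comm B' A'] at hadh2 hbag2
  have hsub1 : ∀ s, splitBag T χ r A' (A' ∩ B') s ⊆ A' := fun s x hx =>
    hx.elim And.right fun h => h.1.1
  have hsub2 : ∀ s, splitBag T χ r B' (A' ∩ B') s ⊆ B' := fun s x hx =>
    hx.elim And.right fun h => h.1.2
  have hnA : ¬ χ r ⊆ A' := fun h => by
    have := ncard_le_ncard (s := B' ∩ χ r) (t := A' ∩ B') (fun x hx => ⟨h hx.2, hx.1⟩) (toFinite _)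
    omega
  have hnB : ¬ χ r ⊆ B' := fun h => by
    have := ncard_le_ncard (s := A' ∩ χ r) (t := A' ∩ B') (fun x hx => ⟨hx.1, h hx.2⟩) (toFinite _)
    omega
  have hmr : m ≤ (χ r).ncard := hA'.trans (ncard_le_ncard inter_subset_right (toFinite _))
  refine hat.false_of_double (r := r) (s₀ := r) ?_ hadh1 hadh2
    ((ncard_le_ncard (inter_subset_inter (hsub1 r) (hsub2 r)) (toFinite _)).trans_lt hm')
    ⟨(hbag1 r).2 hnA, (hbag2 r).2 hnB⟩ ?_
  · refine isTD_double htd.isTree r ?_ ?_ htd.preconnected_splitBag htd.preconnected_splitBag ?_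
    · intro x
      obtain ⟨s, hs⟩ := htd.memBag x
      exact (hAB'.mem_or x).imp (fun h => ⟨s, .inl ⟨hs, h⟩⟩) fun h => ⟨s, .inl ⟨hs, h⟩⟩
    · intro a b hab
      obtain ⟨s, has, hbs⟩ := htd.edgeBag hab
      exact (hAB'.adj_mem_or hab).imp (fun h => ⟨s, .inl ⟨has, h.1⟩, .inl ⟨hbs, h.2⟩⟩)
        fun h => ⟨s, .inl ⟨has, h.1⟩, .inl ⟨hbs, h.2⟩⟩
    · intro x s s' hs hs'
      have hx : x ∈ A' ∩ B' := ⟨hsub1 s hs, hsub2 s' hs'⟩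
      obtain ⟨q, hq⟩ := htd.memBag x
      have hxr : x ∈ sideSet T χ r r := mem_sideSet.2 ⟨q, by rw [branchSet_root]; trivial, hq⟩
      exact ⟨.inr ⟨hx, hxr⟩, .inr ⟨hx, hxr⟩⟩
  · intro s
    by_cases h1 : χ s ⊆ A'
    · refine .inr (.inl ⟨(hbag1 s).1 h1, (ncard_le_ncard ?_ (toFinite _)).trans_lt
        (hm'.trans_le hmr)⟩)
      exact fun x hx => hx.elim (fun h => ⟨h1 h.1, h.2⟩) And.left
    by_cases h2 : χ s ⊆ B'
    · refine .inr (.inr ⟨(hbag2 s).1 h2, (ncard_le_ncard ?_ (toFinite _)).trans_lt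
        (hm'.trans_le hmr)⟩)
      exact fun x hx => hx.elim (fun h => ⟨h.2, h2 h.1⟩) And.left
    · exact .inl ⟨(hbag1 s).2 h1, (hbag2 s).2 h2⟩

theorem eq_of_mem_branchSet_of_adj_root {ι : Type} {T : SimpleGraph ι} (hT : T.IsTree)
    {r y y' q : ι} (hy : T.Adj r y) (hy' : T.Adj r y') (hq : q ∈ branchSet T r y)
    (hq' : q ∈ branchSet T r y') : y = y' := by
  obtain ⟨w, hw, -⟩ := hT.existsUnique_path q r
  exact (hT.isAcyclic.eq_penultimate_of_adj_end hw hy (hq w)).trans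
    (hT.isAcyclic.eq_penultimate_of_adj_end hw hy' (hq' w)).symm

theorem IsTD.eq_of_mem_sideSet {V ι : Type} {G : SimpleGraph V} {T : SimpleGraph ι}
    {χ : ι → Set V} (htd : IsTD G T χ) {r y y' : ι} (hy : T.Adj r y) (hy' : T.Adj r y') {x : V}
    (hx : x ∈ sideSet T χ r y) (hx' : x ∈ sideSet T χ r y') (hxr : x ∉ χ r) : y = y' := by
  obtain ⟨q, hq, hxq⟩ := mem_sideSet.1 hx
  by_cases hq' : q ∈ branchSet T r y'
  · exact eq_of_mem_branchSet_of_adj_root htd.isTree hy hy' hq hq'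
  · exact absurd (htd.mem_inter hy' (notMem_branchSet_of_adj_root hy') hq' hxq hx').1 hxr

/-- A vertex of the root bag cut off by a small separation containing few vertices of the bag
has small degree in the torso. -/
theorem IsAtomicTD.torsoDeg_le {V ι : Type} [Finite V] {m : ℕ} {G : SimpleGraph V}
    {T : SimpleGraph ι} {χ : ι → Set V} (hat : IsAtomicTD m G T χ) {r : ι} {A B : Set V}
    (hAB : IsSeparation G A B) (hm : (A ∩ B).ncard < m) (hB : (B ∩ χ r).ncard < m) {v : V}
    (hvA : v ∉ A) : torsoDeg G T χ r v ≤ m * (m - 1) := by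
  have hvB := (hAB.mem_or v).resolve_left hvA
  let F : V → Set V := fun x =>
    {w | ∃ y, T.Adj r y ∧ x ∈ sideSet T χ r y ∧ x ∉ χ r ∧ w ∈ χ r ∩ χ y}
  have hF : ∀ x, (F x).ncard ≤ m - 1 := by
    intro x
    rcases (F x).eq_empty_or_nonempty with h | ⟨w, y, hy, hxy, hxr, -⟩
    · simp [h]
    · have hsub : F x ⊆ χ r ∩ χ y := by
        rintro w' ⟨y', hy', hxy', -, hw'⟩
        obtain rfl := hat.1.eq_of_mem_sideSet hy hy' hxy hxy' hxr
        exact hw'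
      exact (ncard_le_ncard hsub (toFinite _)).trans (Nat.le_sub_one_of_lt (hat.2.1 hy))
  have hsub : {w | torsoAdj G T χ r v w} ⊆
      (B ∩ χ r) ∪ ⋃ x ∈ (toFinite (A ∩ B)).toFinset, F x := by
    rintro w ⟨hv, hw, -, hvw⟩
    by_cases hwB : w ∈ B
    · exact .inl ⟨hwB, hw⟩
    · right
      have hwA := (hAB.mem_or w).resolve_right hwB
      obtain ⟨y, hy, hvy, hwy⟩ := hvw.resolve_left fun h => hAB.2 w v hwA hwB hvB hvA h.symm
      obtain ⟨x, hx, hxy, hxr⟩ :=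
        hat.exists_mem_inter_branch hy hAB ⟨hv, hvy⟩ ⟨hw, hwy⟩ hvA hwB
      exact mem_biUnion ((toFinite (A ∩ B)).mem_toFinset.2 hx) ⟨y, hy, hxy, hxr, hw, hwy⟩
  have h1 := Finset.set_ncard_biUnion_le (toFinite (A ∩ B)).toFinset F
  have h2 := Finset.sum_le_card_nsmul (toFinite (A ∩ B)).toFinset _ (m - 1) fun x _ => hF x
  rw [smul_eq_mul, ← ncard_eq_toFinset_card (A ∩ B) (toFinite _)] at h2
  calc torsoDeg G T χ r v ≤ _ := ncard_le_ncard hsub (toFinite _)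
    _ ≤ _ := ncard_union_le _ _
    _ ≤ (m - 1) + (m - 1) * (m - 1) := add_le_add (Nat.le_sub_one_of_lt hB)
        (h1.trans (h2.trans (Nat.mul_le_mul_right _ (Nat.le_sub_one_of_lt hm))))
    _ = m * (m - 1) := by
      rw [add_comm, ← Nat.succ_mul, Nat.succ_eq_add_one, Nat.sub_add_cancel (by omega)]

/-- Vertices of large torso degree are not separated by few vertices. -/
theorem IsAtomicTD.le_ncard_inter {V ι : Type} [Finite V] {m : ℕ} {G : SimpleGraph V}
    {T : SimpleGraph ι} {χ : ι → Set V} (hat : IsAtomicTD m G T χ) {r : ι} {u v : V}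
    (hu : m * (m - 1) < torsoDeg G T χ r u) (hv : m * (m - 1) < torsoDeg G T χ r v)
    {A B : Set V} (hAB : IsSeparation G A B) (huB : u ∉ B) (hvA : v ∉ A) :
    m ≤ (A ∩ B).ncard := by
  by_contra! hm
  refine hat.false_of_separation (r := r) hAB hm ?_ ?_
  · by_contra! h
    exact hu.not_ge (hat.torsoDeg_le hAB.symm (by rwa [inter_comm]) h huB)
  · by_contra! h
    exact hv.not_ge (hat.torsoDeg_le hAB hm h hvA)

/-- two `d`-safe non-`t0`-cooperative vertices in the bag of a center of an
`m`-atomic tree decomposition are adjacent. -/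
theorem stmt_8 (t d k m : ℕ) (ht : 1 ≤ t) (hd : 1 ≤ d)
    (hk : ∀ (W : Type) [Fintype W], ∀ (G' : SimpleGraph W) (x y : W),
      MemCt t G' → x ≠ y → ¬ G'.Adj x y →
      (∀ v : W, G'.Adj x v → ¬ IsHub G' v) → ¬ KDisjointPaths G' k x y)
    (hm : m = k + 2 * d) (hm3 : 3 ≤ m)
    {V ι : Type} [Fintype V] (G : SimpleGraph V) (hG : MemCt t G)
    (T : SimpleGraph ι) (χ : ι → Set V) (hTD : IsAtomicTD m G T χ)
    (t0 : ι) (u v : V) (huv : u ≠ v) (hu : u ∈ χ t0) (hv : v ∈ χ t0)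
    (husafe : {w : V | G.Adj u w ∧ IsHub G w}.ncard ≤ d)
    (hvsafe : {w : V | G.Adj v w ∧ IsHub G w}.ncard ≤ d)
    (hudeg : 2 * m * (m - 1) ≤ torsoDeg G T χ t0 u)
    (hvdeg : 2 * m * (m - 1) ≤ torsoDeg G T χ t0 v) :
    G.Adj u v := by
  classical
  by_contra hadj
  have hdeg : m * (m - 1) < 2 * m * (m - 1) := by
    have : 0 < m * (m - 1) := Nat.mul_pos (by omega) (by omega)
    rw [mul_assoc]
    omega
  set H : Set V := {w | G.Adj u w ∧ IsHub G w} with hH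
  have huH : u ∉ H := fun h => h.1.ne rfl
  have hvH : v ∉ H := fun h => hadj h.1
  have hpaths : KDisjointPaths (G.induce Hᶜ) k ⟨u, huH⟩ ⟨v, hvH⟩ :=
    kDisjointPaths_of_separations huv hadj huH hvH fun A B hAB _ huB _ hvA =>
      (by omega : k + H.ncard ≤ m).trans
        (hTD.le_ncard_inter (hdeg.trans_le hudeg) (hdeg.trans_le hvdeg) hAB huB hvA)
  let φ : G.induce Hᶜ ↪g G := SimpleGraph.Embedding.induce Hᶜ
  exact hk _ (G.induce Hᶜ) ⟨u, huH⟩ ⟨v, hvH⟩ (hG.of_embedding φ)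
    (fun h => huv (congrArg Subtype.val h)) (fun h => hadj h)
    (fun w hw hhub => w.2 ⟨hw, hhub.map φ⟩) hpaths
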